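/- Let n ≥ 2 and let h be a Hessenberg function for type D_n. Then the classes v^{(h)}_m := ∏_{i=1}^{n} α^{(h−m)}_{i,h(i)}·α^{(h−m)}_{i,h(i)−1}···α^{(h−m)}_{i,h(i)−m_i+1}, indexed by tuples m = (m_1,…,m_n) with 0 ≤ m_i ≤ h(i)−i (an empty product being 1), form a basis of the ℝ-vector space R^{D}_{h} = ℝ[x_1,…,x_n]/(f^{D}_{1,h(1)},…,f^{D}_{n,h(n)}). -/

import Mathlib

open MvPolynomial

noncomputable section

/-- The variable `x_k` (1-indexed) of `ℝ[x_1,…,x_n]`. -/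
def xv (n : ℕ) (k : ℕ) : MvPolynomial (Fin n) ℝ :=
  if h : 1 ≤ k ∧ k ≤ n then X ⟨k - 1, by omega⟩ else 0

/-- The type `D_n` root label `α_{i,j}` with variables given by `x`:
for `i ≤ n−1`, `x_i − x_j` if `j ≤ n` and `x_i + x_{2n−j}` if `n+1 ≤ j ≤ 2n−i−1`;
and `α_{n,j} = x_{2n−j} + x_n` for `n+1 ≤ j ≤ 2n−1`. -/
def alD {R : Type*} [CommRing R] (x : ℕ → R) (n i j : ℕ) : R :=
  if i = n then x (2 * n - j) + x n
  else if j ≤ n then x i - x j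
  else x i + x (2 * n - j)

/-- Labels of the steps of the reduction procedure on integer vectors. -/
inductive DLabel : Type
  | r1 | r2 | r3
  deriving DecidableEq

/-- The label of the procedure step `ℓ → ℓ'` for a vector `ℓ = (ℓ_1,…,ℓ_n)`:
`(1r)` if `ℓ_n < 2n−1` and `ℓ_1 ≤ n`; `(3r)` if `ℓ_n < 2n−1` and `ℓ_1 ≥ n+1`;
`(2r)` if `ℓ_n = 2n−1` and `ℓ_1 ≤ n−1`; undefined (`none`) otherwise. -/
def dStepLabel (n : ℕ) (ℓ : ℕ → ℤ) : Option DLabel :=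
  if ℓ n < 2 * (n : ℤ) - 1 then
    (if ℓ 1 ≤ (n : ℤ) then some DLabel.r1 else some DLabel.r3)
  else if ℓ 1 ≤ (n : ℤ) - 1 then some DLabel.r2 else none

/-- The vector `ℓ' = (ℓ_2−1,…,ℓ_{n−1}−1, last)` produced by one procedure step, where the
last entry is `ℓ_1+n−2` if `ℓ_n = 2n−1` and `ℓ_n−1` otherwise. -/
def dStepVec (n : ℕ) (ℓ : ℕ → ℤ) : ℕ → ℤ := fun i =>
  if i = n - 1 then (if ℓ n = 2 * (n : ℤ) - 1 then ℓ 1 + (n : ℤ) - 2 else ℓ n - 1)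
  else ℓ (i + 1) - 1

/-- `dStage n ℓ s` is the vector `ℓ^{(s+1)}` (of size `n−s`) obtained by iterating the
procedure `s` times from `ℓ^{(1)} = ℓ` (of size `n`), or `none` if some step is undefined. -/
def dStage (n : ℕ) (ℓ : ℕ → ℤ) : ℕ → Option (ℕ → ℤ)
  | 0 => some ℓ
  | s + 1 => (dStage n ℓ s).bind fun v =>
      if (dStepLabel (n - s) v).isSome then some (dStepVec (n - s) v) else none

/-- The label of the step `ℓ^{(s)} → ℓ^{(s+1)}` (1-based stage `s`), if defined. -/
def dLabelAt (n : ℕ) (ℓ : ℕ → ℤ) (s : ℕ) : Option DLabel :=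
  (dStage n ℓ (s - 1)).bind fun v => dStepLabel (n - (s - 1)) v

/-- The modified root `α^{(ℓ)}_{i,j}` with variables given by `x`:
`α^{(ℓ)}_{n,2n−r} = x_r` if the step at stage `r` has label `(3r)`, and `x_r + x_n`
otherwise; and for `i ≤ n−1`, with `k = n−j+i`, `α^{(ℓ)}_{i,j} = x_k` if the steps at
stages `i`, `k` have labels `(2r)`, `(3r)` and `i < k`, `x_i − x_k` if they have labels
`(2r)`, `(1r)` and `i < k`, and `α_{i,j}` otherwise. -/
def alDMod {R : Type*} [CommRing R] (x : ℕ → R) (n : ℕ) (ℓ : ℕ → ℤ) (i j : ℕ) : R :=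
  if i = n then
    (if dLabelAt n ℓ (2 * n - j) = some DLabel.r3 then x (2 * n - j)
     else x (2 * n - j) + x n)
  else if i < n - j + i ∧ dLabelAt n ℓ i = some DLabel.r2 ∧
      dLabelAt n ℓ (n - j + i) = some DLabel.r3 then x (n - j + i)
  else if i < n - j + i ∧ dLabelAt n ℓ i = some DLabel.r2 ∧
      dLabelAt n ℓ (n - j + i) = some DLabel.r1 then x i - x (n - j + i)
  else alD x n i j

/-- The type `D_n` polynomials `f^{D}_{i,j}` (with `f^{D}_{n,2n−1−r}` encoded at `i = n`,
`j = 2n−1−r`). -/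
def fDij (n i j : ℕ) : MvPolynomial (Fin n) ℝ :=
  if i = n then
    (∑ k ∈ Finset.Icc 1 (2 * n - 1 - j),
        ((-1 : ℝ) ^ (n - (2 * n - 1 - j) + 1)) •
          ∏ ℓ ∈ Finset.Icc (2 * n - 1 - j + 1) n, (xv n k - xv n ℓ)) +
      (n : ℝ) • ∏ ℓ ∈ Finset.Icc (2 * n - 1 - j + 1) n, xv n ℓ
  else if j ≤ n - 2 then
    ∑ k ∈ Finset.Icc 1 i, (∏ ℓ ∈ Finset.Icc (i + 1) j, (xv n k - xv n ℓ)) * xv n k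
  else if j = n - 1 then
    (∑ k ∈ Finset.Icc 1 i,
        (∏ ℓ ∈ Finset.Icc (i + 1) (n - 1), (xv n k - xv n ℓ)) * (xv n k + xv n n)) +
      ((-1 : ℝ) ^ (n - i) * (n : ℝ)) • ∏ ℓ ∈ Finset.Icc (i + 1) n, xv n ℓ
  else
    (∑ k ∈ Finset.Icc 1 i,
        (∏ ℓ ∈ Finset.Icc (i + 1) n, (xv n k - xv n ℓ)) *
          ∏ t ∈ Finset.Icc (n - (j - n)) n, (xv n k + xv n t)) +
      ((-1 : ℝ) ^ (n - i + 1) * (n : ℝ)) •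
        ((∏ ℓ ∈ Finset.Icc (i + 1) (n - 1 - (j - n)), xv n ℓ) *
          ∏ t ∈ Finset.Icc (n - (j - n)) n, xv n t ^ 2)

/-- The ideal `(f^{D}_{1,h(1)}, …, f^{D}_{n,h(n)})`,
so that `R^{D}_h = ℝ[x_1,…,x_n]/IDh n h ≅ H^*(Hess(N,h);ℝ)` in type `D_n`. -/
def IDh (n : ℕ) (h : ℕ → ℕ) : Ideal (MvPolynomial (Fin n) ℝ) :=
  Ideal.span ((fun i => fDij n i (h i)) '' Set.Icc 1 n)

/-- The integer vector `h − m` (1-indexed entries `h(i) − m_i`). -/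
def ellOf (n : ℕ) (h : ℕ → ℕ)
    (m : (i : Fin n) → Fin (h (i.val + 1) - (i.val + 1) + 1)) : ℕ → ℤ := fun r =>
  if hr : 1 ≤ r ∧ r ≤ n then (h r : ℤ) - ((m ⟨r - 1, by omega⟩ : ℕ) : ℤ) else 0

/-- The class `v^{(h)}_m = ∏_{i=1}^{n} α^{(h−m)}_{i,h(i)}···α^{(h−m)}_{i,h(i)−m_i+1}`
in `R^{D}_h`. -/
def vDh (n : ℕ) (h : ℕ → ℕ)
    (m : (i : Fin n) → Fin (h (i.val + 1) - (i.val + 1) + 1)) :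
    MvPolynomial (Fin n) ℝ ⧸ IDh n h :=
  Ideal.Quotient.mk (IDh n h)
    (∏ i : Fin n, ∏ t ∈ Finset.range (m i : ℕ),
      alDMod (xv n) n (ellOf n h m) (i.val + 1) (h (i.val + 1) - t))

/-- The tuples of natural numbers indexed by `Fin n` whose sum is at most `e`. -/
def simplexPoints (n e : ℕ) : Finset (Fin n → ℕ) :=
  (Fintype.piFinset fun _ => Finset.range (e + 1)).filter fun a => ∑ i, a i ≤ e

theorem mem_simplexPoints {n e : ℕ} {a : Fin n → ℕ} :
    a ∈ simplexPoints n e ↔ ∑ i, a i ≤ e := by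
  simp only [simplexPoints, Finset.mem_filter, Fintype.mem_piFinset, Finset.mem_range,
    and_iff_right_iff_imp]
  intro h i
  have := Finset.single_le_sum (f := a) (fun i _ => Nat.zero_le _) (Finset.mem_univ i)
  omega

theorem card_simplexPoints_le (n e : ℕ) : (simplexPoints n e).card ≤ (e + 1) ^ n := by
  refine (Finset.card_filter_le _ _).trans ?_
  simp

theorem card_simplexPoints_pos (n e : ℕ) : 0 < (simplexPoints n e).card :=
  Finset.card_pos.2 ⟨0, mem_simplexPoints.2 (by simp)⟩

/-- A rational growth rate cannot exceed one for a polynomially bounded count. -/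
theorem le_of_mul_card_simplexPoints_le {n D P N : ℕ}
    (H : ∀ e, P * (simplexPoints n e).card ≤ N * (simplexPoints n (e + D)).card) : P ≤ N := by
  by_contra! hlt
  have hN : 0 < N := by
    rcases Nat.eq_zero_or_pos N with h0 | h0
    · have := H 0
      have hpos := card_simplexPoints_pos n 0
      subst h0
      nlinarith [Nat.mul_pos hlt hpos]
    · exact h0
  have hNr : (0 : ℝ) < N := by exact_mod_cast hN
  have hr : (1 : ℝ) < (P : ℝ) / N := by
    rw [lt_div_iff₀ hNr]; simpa using (by exact_mod_cast hlt : (N : ℝ) < P)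
  have growth : ∀ k : ℕ, ((P : ℝ) / N) ^ k ≤ (simplexPoints n (k * D)).card := by
    intro k
    induction k with
    | zero => simpa using card_simplexPoints_pos n 0
    | succ k ih =>
      have h1 : (P : ℝ) * (simplexPoints n (k * D)).card ≤
          N * (simplexPoints n (k * D + D)).card := by exact_mod_cast H (k * D)
      have h2 : (P : ℝ) / N * (simplexPoints n (k * D)).card ≤
          (simplexPoints n (k * D + D)).card := by
        rw [div_mul_eq_mul_div, div_le_iff₀ hNr]; linarith
      rw [pow_succ, Nat.succ_mul]
      have hr0 : (0 : ℝ) ≤ (P : ℝ) / N := by positivity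
      nlinarith
  have bound : ∀ k : ℕ, 1 ≤ k → ((P : ℝ) / N) ^ k ≤ ((D : ℝ) + 1) ^ n * (k : ℝ) ^ n := by
    intro k hk
    refine (growth k).trans ?_
    have h1 : ((simplexPoints n (k * D)).card : ℝ) ≤ ((k * D + 1 : ℕ) : ℝ) ^ n := by
      exact_mod_cast card_simplexPoints_le n (k * D)
    refine h1.trans ?_
    rw [← mul_pow]
    have hk' : (1 : ℝ) ≤ k := by exact_mod_cast hk
    gcongr
    push_cast
    linarith
  have lim := (tendsto_pow_const_div_const_pow_of_one_lt n hr).const_mul (((D : ℝ) + 1) ^ n)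
  rw [mul_zero] at lim
  obtain ⟨k, hk1, hk2⟩ := ((lim.eventually (gt_mem_nhds one_pos)).and
    (Filter.eventually_ge_atTop 1)).exists
  have hpos : (0 : ℝ) < ((P : ℝ) / N) ^ k := by positivity
  have := bound k hk2
  rw [← mul_div_assoc, div_lt_one hpos] at hk1
  linarith

/-- Weighted tuples `a` with `∑ a i * d i ≤ e`, combined with residues modulo `d`, embed into the
tuples of bounded sum. -/
theorem prod_mul_card_weighted_le {n : ℕ} (d : Fin n → ℕ) (hd : ∀ i, 0 < d i) (e : ℕ) :
    (∏ i, d i) * ((simplexPoints n e).filter fun a => ∑ i, a i * d i ≤ e).card ≤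
      (simplexPoints n (e + ∑ i, d i)).card := by
  have hcard : (∏ i, d i) = (Fintype.piFinset fun i => Finset.range (d i)).card := by simp
  rw [hcard, ← Finset.card_product]
  refine Finset.card_le_card_of_injOn (fun p i => p.2 i * d i + p.1 i) ?_ ?_
  · rintro ⟨r, a⟩ h
    simp only [Finset.coe_product, Set.mem_prod, Finset.mem_coe, Fintype.mem_piFinset,
      Finset.mem_range, Finset.mem_filter] at h
    rw [Finset.mem_coe, mem_simplexPoints, Finset.sum_add_distrib]
    exact add_le_add h.2.2 (Finset.sum_le_sum fun i _ => (h.1 i).le)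
  · rintro ⟨r, a⟩ h ⟨r', a'⟩ h' heq
    simp only [Finset.coe_product, Set.mem_prod, Finset.mem_coe, Fintype.mem_piFinset,
      Finset.mem_range, Finset.mem_filter] at h h'
    have key : ∀ i, r i = r' i ∧ a i = a' i := by
      intro i
      have hi : a i * d i + r i = a' i * d i + r' i := congrFun heq i
      have h1 := congrArg (· % d i) hi
      simp only [Nat.mul_add_mod_self_right, Nat.mod_eq_of_lt (h.1 i),
        Nat.mod_eq_of_lt (h'.1 i)] at h1
      refine ⟨h1, ?_⟩
      rw [h1] at hi
      exact Nat.eq_of_mul_eq_mul_right (hd i) (by omega)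
    exact Prod.ext (funext fun i => (key i).1) (funext fun i => (key i).2)

theorem homogeneousComponent_mul_of_isHomogeneous {σ : Type*} {f g : MvPolynomial σ ℝ} {d : ℕ}
    (hf : f.IsHomogeneous d) (e : ℕ) :
    homogeneousComponent e (g * f) =
      if d ≤ e then homogeneousComponent (e - d) g * f else 0 := by
  induction g using MvPolynomial.induction_on' with
  | monomial u c =>
    have hu : (monomial u c).IsHomogeneous u.degree := isHomogeneous_monomial c rfl
    rw [homogeneousComponent_of_mem (hu.mul hf), homogeneousComponent_of_mem hu]
    split_ifs <;> first | rfl | omega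
  | add p q hp hq =>
    rw [add_mul, map_add, hp, hq]
    split_ifs <;> simp [add_mul]

section HomogeneousQuotient

variable {n : ℕ} {ι : Type*} [Fintype ι] {d : Fin n → ℕ} {f : Fin n → MvPolynomial (Fin n) ℝ}
  {ε : ι → ℕ} {b : ι → MvPolynomial (Fin n) ℝ}

theorem isHomogeneous_mem_span_mul_prod (hd : ∀ i, 0 < d i) (hf : ∀ i, (f i).IsHomogeneous (d i))
    (hb : ∀ j, (b j).IsHomogeneous (ε j))
    (hspan : Submodule.span ℝ
      (Set.range fun j => Ideal.Quotient.mk (Ideal.span (Set.range f)) (b j)) = ⊤)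
    (e : ℕ) (p : MvPolynomial (Fin n) ℝ) (hp : p.IsHomogeneous e) :
    p ∈ Submodule.span ℝ {q | ∃ j, ∃ a : Fin n → ℕ, ∑ i, a i * d i ≤ e ∧
      q = b j * ∏ i, f i ^ a i} := by
  induction e using Nat.strong_induction_on generalizing p with
  | _ e ih =>
    have hmem : Ideal.Quotient.mk (Ideal.span (Set.range f)) p ∈ Submodule.span ℝ
      (Set.range fun j => Ideal.Quotient.mk (Ideal.span (Set.range f)) (b j)) := by
      rw [hspan]; trivial
    obtain ⟨c, hc⟩ := (Submodule.mem_span_range_iff_exists_fun ℝ).1 hmem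
    have hdiff : p - ∑ j, c j • b j ∈ Ideal.span (Set.range f) := by
      rw [← Ideal.Quotient.eq, ← hc, map_sum]
      rfl
    obtain ⟨g, hg⟩ := Ideal.mem_span_range_iff_exists_fun.1 hdiff
    have hpe : p = ∑ j, c j • homogeneousComponent e (b j) +
        ∑ i, homogeneousComponent e (g i * f i) := by
      have h1 : p = ∑ j, c j • b j + ∑ i, g i * f i := by rw [hg]; ring
      have h2 := congrArg (homogeneousComponent e) h1
      rw [homogeneousComponent_eq_self hp] at h2
      simpa [map_sum] using h2
    rw [hpe]
    refine Submodule.add_mem _ (Submodule.sum_mem _ fun j _ => Submodule.smul_mem _ _ ?_)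
      (Submodule.sum_mem _ fun i _ => ?_)
    · rw [homogeneousComponent_of_mem (hb j)]
      split_ifs
      · exact Submodule.subset_span ⟨j, 0, by simp, by simp⟩
      · exact Submodule.zero_mem _
    · rw [homogeneousComponent_mul_of_isHomogeneous (hf i)]
      split_ifs with hle
      · have hmem := ih (e - d i) (by have := hd i; omega) _
          (homogeneousComponent_isHomogeneous (e - d i) (g i))
        have himg := Submodule.apply_mem_span_image_of_mem_span
          (LinearMap.mulRight ℝ (f i)) hmem
        refine Submodule.span_mono ?_ himg
        rintro _ ⟨_, ⟨j, a, ha, rfl⟩, rfl⟩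
        refine ⟨j, a + Pi.single i 1, ?_, ?_⟩
        · simp only [Pi.add_apply, add_mul, Finset.sum_add_distrib, Pi.single_apply, ite_mul,
            one_mul, zero_mul, Finset.sum_ite_eq', Finset.mem_univ, if_true]
          omega
        · simp only [LinearMap.mulRight_apply, Pi.add_apply, pow_add, Finset.prod_mul_distrib,
            mul_assoc, Pi.single_apply, pow_ite, pow_one, pow_zero, Finset.prod_ite_eq',
            Finset.mem_univ, if_true]
      · exact Submodule.zero_mem _

/-- If a quotient of a polynomial ring in `n` variables by `n` homogeneous polynomials of positive
degrees is spanned by `N` homogeneous classes, then `N` is at least the product of the degrees. -/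
theorem prod_degrees_le_card (hd : ∀ i, 0 < d i) (hf : ∀ i, (f i).IsHomogeneous (d i))
    (hb : ∀ j, (b j).IsHomogeneous (ε j))
    (hspan : Submodule.span ℝ
      (Set.range fun j => Ideal.Quotient.mk (Ideal.span (Set.range f)) (b j)) = ⊤) :
    ∏ i, d i ≤ Fintype.card ι := by
  classical
  refine le_of_mul_card_simplexPoints_le (n := n) (D := ∑ i, d i) fun e => ?_
  set T := (simplexPoints n e).filter fun a => ∑ i, a i * d i ≤ e with hT
  let s : Finset (MvPolynomial (Fin n) ℝ) :=
    (Finset.univ ×ˢ T).image fun q : ι × (Fin n → ℕ) => b q.1 * ∏ i, f i ^ q.2 i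
  let v : simplexPoints n e → MvPolynomial (Fin n) ℝ :=
    fun a => monomial (Finsupp.equivFunOnFinite.symm a.1) 1
  have hv : LinearIndependent ℝ v := by
    have h1 := (basisMonomials (Fin n) ℝ).linearIndependent
    have h2 := h1.comp (fun a : simplexPoints n e => Finsupp.equivFunOnFinite.symm a.1)
      (fun a a' h => Subtype.ext (Finsupp.equivFunOnFinite.symm.injective h))
    simpa [v, Function.comp_def] using h2
  have hle : Set.range v ≤ Submodule.span ℝ (s : Set (MvPolynomial (Fin n) ℝ)) := by
    rintro _ ⟨⟨a, ha⟩, rfl⟩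
    have hhom : (v ⟨a, ha⟩).IsHomogeneous (∑ i, a i) := by
      refine isHomogeneous_monomial _ ?_
      simp [Finsupp.degree_eq_sum]
    refine Submodule.span_mono ?_ (isHomogeneous_mem_span_mul_prod hd hf hb hspan _ _ hhom)
    rintro _ ⟨j, c, hc, rfl⟩
    have ha' := mem_simplexPoints.1 ha
    refine Finset.mem_coe.2 (Finset.mem_image.2 ⟨(j, c), ?_, rfl⟩)
    simp only [Finset.mem_product, Finset.mem_univ, true_and, hT, Finset.mem_filter,
      mem_simplexPoints]
    refine ⟨?_, by omega⟩
    have : ∑ i, c i ≤ ∑ i, c i * d i :=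
      Finset.sum_le_sum fun i _ => Nat.le_mul_of_pos_right _ (hd i)
    omega
  have hcard : (simplexPoints n e).card ≤ Fintype.card ι * T.card := by
    have h1 : Fintype.card (simplexPoints n e) ≤ s.card := by
      have := linearIndependent_le_span_aux' v hv (s : Set (MvPolynomial (Fin n) ℝ)) hle
      simpa using this
    rw [Fintype.card_coe] at h1
    refine h1.trans (Finset.card_image_le.trans ?_)
    rw [Finset.card_product, Finset.card_univ]
  calc (∏ i, d i) * (simplexPoints n e).card
      ≤ (∏ i, d i) * (Fintype.card ι * T.card) := Nat.mul_le_mul_left _ hcard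
    _ = Fintype.card ι * ((∏ i, d i) * T.card) := by ring
    _ ≤ _ := Nat.mul_le_mul_left _ (prod_mul_card_weighted_le d hd e)

end HomogeneousQuotient

/-- A spanning family of homogeneous classes whose size is the product of the degrees of the
relations is linearly independent. -/
theorem linearIndependent_of_card_eq_prod_degrees {n : ℕ} {ι : Type*} [Fintype ι] {d : Fin n → ℕ}
    {f : Fin n → MvPolynomial (Fin n) ℝ} {ε : ι → ℕ} {b : ι → MvPolynomial (Fin n) ℝ}
    (hd : ∀ i, 0 < d i) (hf : ∀ i, (f i).IsHomogeneous (d i))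
    (hb : ∀ j, (b j).IsHomogeneous (ε j))
    (hspan : Submodule.span ℝ
      (Set.range fun j => Ideal.Quotient.mk (Ideal.span (Set.range f)) (b j)) = ⊤)
    (hcard : Fintype.card ι = ∏ i, d i) :
    LinearIndependent ℝ fun j => Ideal.Quotient.mk (Ideal.span (Set.range f)) (b j) := by
  classical
  obtain ⟨κ, a, ha, hκ, hli⟩ := exists_linearIndependent' ℝ
    (fun j => Ideal.Quotient.mk (Ideal.span (Set.range f)) (b j))
  have : Fintype κ := Fintype.ofInjective a ha
  have hle : ∏ i, d i ≤ Fintype.card κ :=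
    prod_degrees_le_card (b := b ∘ a) (ε := ε ∘ a) hd hf (fun j => hb (a j))
      (by rw [← hspan, ← hκ]; rfl)
  have hbij : Function.Bijective a := by
    rw [Fintype.bijective_iff_injective_and_card]
    exact ⟨ha, le_antisymm (Fintype.card_le_of_injective a ha) (by omega)⟩
  exact (linearIndependent_equiv (Equiv.ofBijective a hbij)).1 hli

section Absorb

variable {A : Type*} [CommRing A] [Algebra ℝ A]

/-- The ideal of elements `z` with `c * z * A ⊆ W`. -/
def absorb (W : Submodule ℝ A) (c : A) : Ideal A where
  carrier := {z | ∀ y, c * (z * y) ∈ W}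
  add_mem' {a b} ha hb y := by
    have h : c * ((a + b) * y) = c * (a * y) + c * (b * y) := by ring
    rw [h]; exact W.add_mem (ha y) (hb y)
  zero_mem' y := by simp
  smul_mem' a b hb y := by
    have h : c * (a • b * y) = c * (b * (a * y)) := by rw [smul_eq_mul]; ring
    rw [h]; exact hb _

variable {W : Submodule ℝ A} {c z : A}

theorem mem_absorb : z ∈ absorb W c ↔ ∀ y, c * (z * y) ∈ W := Iff.rfl

theorem mem_absorb_mul {d : A} : z ∈ absorb W (c * d) ↔ d * z ∈ absorb W c := by
  simp only [mem_absorb, mul_assoc]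

theorem mem_absorb_of_mul_eq_zero (h : c * z = 0) : z ∈ absorb W c := fun y => by
  rw [← mul_assoc, h, zero_mul]; exact W.zero_mem

theorem mem_absorb_of_absorb_mul_eq_top (h : absorb W (c * z) = ⊤) : z ∈ absorb W c := by
  have h1 : (1 : A) ∈ absorb W (c * z) := h ▸ Submodule.mem_top
  simpa using mem_absorb_mul.1 h1

theorem eq_top_of_absorb_one_eq_top (h : absorb W 1 = ⊤) : W = ⊤ := by
  refine Submodule.eq_top_iff'.2 fun z => ?_
  have hz : z ∈ absorb W 1 := h ▸ Submodule.mem_top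
  simpa using hz 1

theorem absorb_eq_top_of_span_quotient (S : Set (A ⧸ absorb W c)) (hS : Submodule.span ℝ S = ⊤)
    (hW : ∀ s ∈ S, ∃ v, Ideal.Quotient.mk (absorb W c) v = s ∧ c * v ∈ W) :
    absorb W c = ⊤ := by
  have key : ∀ s : A ⧸ absorb W c, ∃ v, Ideal.Quotient.mk (absorb W c) v = s ∧ c * v ∈ W := by
    intro s
    have hs : s ∈ Submodule.span ℝ S := hS ▸ Submodule.mem_top
    induction hs using Submodule.span_induction with
    | mem s hs => exact hW s hs
    | zero => exact ⟨0, map_zero _, by simp⟩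
    | add a b _ _ ha hb =>
      obtain ⟨u, rfl, hu⟩ := ha
      obtain ⟨v, rfl, hv⟩ := hb
      exact ⟨u + v, map_add _ _ _, by rw [mul_add]; exact W.add_mem hu hv⟩
    | smul r a _ ha =>
      obtain ⟨u, rfl, hu⟩ := ha
      exact ⟨r • u, rfl, by rw [mul_smul_comm]; exact W.smul_mem _ hu⟩
  refine (Ideal.eq_top_iff_one _).2 fun y => ?_
  obtain ⟨v, hv, hvW⟩ := key (Ideal.Quotient.mk _ y)
  have h1 : y - v ∈ absorb W c := (Ideal.Quotient.eq).1 hv.symm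
  have h2 := W.add_mem (h1 1) hvW
  convert h2 using 1
  ring

theorem adjoin_image_quotient_eq_top {x : ℕ → A} {T : Set ℕ} (hx : Algebra.adjoin ℝ (x '' T) = ⊤)
    (K : Ideal A) :
    Algebra.adjoin ℝ ((fun k => Ideal.Quotient.mk K (x k)) '' T) = ⊤ := by
  have h := congrArg (Subalgebra.map (Ideal.Quotient.mkₐ ℝ K)) hx
  rw [AlgHom.map_adjoin, Algebra.map_top, ← Set.image_comp,
    (AlgHom.range_eq_top _).2 (Ideal.Quotient.mkₐ_surjective ℝ K)] at h
  exact h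

end Absorb

section Factors

variable {A : Type*} [CommRing A]

/-- The linear factor attached to the column `p`: `t - x_p` for `p ≤ n` and `t + x_{2n-p}`
otherwise. -/
def colFactor (x : ℕ → A) (n p : ℕ) (t : A) : A :=
  if p ≤ n then t - x p else t + x (2 * n - p)

/-- The summand of the polynomials `f_{i,j}` (`i < n`) attached to the value `t`. -/
def rowTerm (x : ℕ → A) (n i j : ℕ) (t : A) : A :=
  (if j ≤ n - 2 then t else t + x n) * ∏ p ∈ Finset.Ioc i j, colFactor x n p t

/-- The summand of the polynomials `f_{n,2n-1-r}` attached to the value `t`. -/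
def lastTerm (x : ℕ → A) (n r : ℕ) (t : A) : A :=
  ∏ p ∈ Finset.Ioc r n, (t - x p)

variable {x : ℕ → A} {n i j : ℕ} {t : A}

theorem alD_eq_colFactor (x : ℕ → A) (hi : i ≠ n) (p : ℕ) :
    alD x n i p = colFactor x n p (x i) := by
  simp [alD, colFactor, hi]

theorem map_colFactor {B : Type*} [CommRing B] (q : A →+* B) (p : ℕ) :
    q (colFactor x n p t) = colFactor (fun k => q (x k)) n p (q t) := by
  unfold colFactor; split_ifs <;> simp

theorem map_rowTerm {B : Type*} [CommRing B] (q : A →+* B) :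
    q (rowTerm x n i j t) = rowTerm (fun k => q (x k)) n i j (q t) := by
  unfold rowTerm; split_ifs <;> simp [map_prod, map_colFactor]

theorem map_lastTerm {B : Type*} [CommRing B] (q : A →+* B) (r : ℕ) :
    q (lastTerm x n r t) = lastTerm (fun k => q (x k)) n r (q t) := by
  simp [lastTerm, map_prod]

theorem rowTerm_eq_zero_of_colFactor {p : ℕ} (hip : i < p) (hpj : p ≤ j)
    (h : colFactor x n p t = 0) : rowTerm x n i j t = 0 := by
  rw [rowTerm, Finset.prod_eq_zero (Finset.mem_Ioc.2 ⟨hip, hpj⟩) h, mul_zero]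

theorem rowTerm_eq_zero_of_add (hj : ¬ j ≤ n - 2) (h : t + x n = 0) : rowTerm x n i j t = 0 := by
  simp [rowTerm, hj, h]

theorem lastTerm_eq_zero {r p : ℕ} (hrp : r < p) (hpn : p ≤ n) (h : t = x p) :
    lastTerm x n r t = 0 :=
  Finset.prod_eq_zero (Finset.mem_Ioc.2 ⟨hrp, hpn⟩) (by simp [h])

/-- For `j ≥ n` the factors of `rowTerm` split into differences and sums. -/
theorem rowTerm_eq_prod_mul_prod (hin : i < n) (hj : n ≤ j) (hj2 : j < 2 * n) :
    rowTerm x n i j t =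
      (∏ p ∈ Finset.Ioc i n, (t - x p)) * ∏ p ∈ Finset.Icc (2 * n - j) n, (t + x p) := by
  have hsplit : ∏ p ∈ Finset.Ioc i j, colFactor x n p t =
      (∏ p ∈ Finset.Ioc i n, (t - x p)) * ∏ p ∈ Finset.Ioc n j, (t + x (2 * n - p)) := by
    rw [← Finset.prod_Ioc_consecutive _ hin.le hj]
    congr 1
    · exact Finset.prod_congr rfl fun p hp => by simp [colFactor, (Finset.mem_Ioc.1 hp).2]
    · exact Finset.prod_congr rfl fun p hp => by
        simp [colFactor, not_le.2 (Finset.mem_Ioc.1 hp).1]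
  have hrefl : ∏ p ∈ Finset.Ioc n j, (t + x (2 * n - p)) =
      ∏ p ∈ Finset.Ico (2 * n - j) n, (t + x p) := by
    refine Finset.prod_bij' (fun p _ => 2 * n - p) (fun p _ => 2 * n - p) ?_ ?_ ?_ ?_ ?_ <;>
      intro p hp <;> simp only [Finset.mem_Ioc, Finset.mem_Ico] at hp ⊢ <;> omega
  have hlast : ∏ p ∈ Finset.Icc (2 * n - j) n, (t + x p) =
      (∏ p ∈ Finset.Ico (2 * n - j) n, (t + x p)) * (t + x n) := by
    rw [← Finset.prod_Ico_succ_top (by omega)]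
    rfl
  rw [rowTerm, if_neg (by omega), hsplit, hrefl, hlast]
  ring

/-- When `j` is maximal, `rowTerm` is an even function. -/
theorem rowTerm_neg (hin : i < n) (hj : j + i + 1 = 2 * n) :
    rowTerm x n i j (-t) = rowTerm x n i j t := by
  have hI : Finset.Icc (2 * n - j) n = Finset.Ioc i n := by
    ext p; simp only [Finset.mem_Icc, Finset.mem_Ioc]; omega
  rw [rowTerm_eq_prod_mul_prod hin (by omega) (by omega),
    rowTerm_eq_prod_mul_prod hin (by omega) (by omega), hI, ← Finset.prod_mul_distrib,
    ← Finset.prod_mul_distrib]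
  exact Finset.prod_congr rfl fun p _ => by ring

end Factors

/-- Monotonicity up to the maximal value propagates along an interval. -/
theorem le_or_eq_max_of_step {n s : ℕ} {h : ℕ → ℕ}
    (hmax : ∀ i, s ≤ i → i < n → h i + i + 1 ≤ 2 * n)
    (hstep : ∀ i, s ≤ i → i + 1 < n → h i ≤ h (i + 1) ∨ h (i + 1) + i + 2 = 2 * n)
    {a i : ℕ} (hsa : s ≤ a) (hai : a ≤ i) (hin : i < n) :
    h a ≤ h i ∨ h i + i + 1 = 2 * n := by
  induction i, hai using Nat.le_induction with
  | base => exact Or.inl le_rfl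
  | succ i hai ih =>
    have h1 := hstep i (by omega) hin
    have h2 := ih (by omega)
    have h3 := hmax (i + 1) (by omega) hin
    have h4 := hmax i (by omega) (by omega)
    omega

section EvenSpan

universe v

/-- The products of linear factors indexed by `s ≤ i < n`. -/
def rowProducts {A : Type*} [CommRing A] (n s : ℕ) (h : ℕ → ℕ) (x : ℕ → A) : Set A :=
  {v | ∃ L : ℕ → ℕ, (∀ i, s ≤ i → i < n → i ≤ L i ∧ L i ≤ h i) ∧
    v = ∏ i ∈ Finset.Ico s n, ∏ p ∈ Finset.Ioc (L i) (h i), colFactor x n p (x i)}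

/-- A weighted system of relations `∑_{s ≤ k ≤ i} u_k f_{i,h(i)}(x_k) = 0` in which one of the
variables vanishes. -/
structure RowSystem {A : Type*} [CommRing A] [Algebra ℝ A] (n s : ℕ) (h : ℕ → ℕ) (x : ℕ → A)
    (u : ℕ → ℝ) (j : ℕ) : Prop where
  le_j : s ≤ j
  j_le : j ≤ n
  zero : x j = 0
  pos : ∀ k, s ≤ k → k ≤ n → k ≠ j → 0 < u k
  sum : ∑ k ∈ Finset.Icc s n, u k = 0
  adjoin : Algebra.adjoin ℝ (x '' Set.Icc s n) = ⊤
  rel : ∀ i, s ≤ i → i < n → ∑ k ∈ Finset.Icc s i, u k • rowTerm x n i (h i) (x k) = 0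

theorem adjoin_eq_top_of_mem {A : Type*} [CommRing A] [Algebra ℝ A] {x : ℕ → A} {s n l : ℕ}
    (hl : s + 1 ≤ l) (hln : l ≤ n) (hx : x s = x l ∨ x s = -x l)
    (hadj : Algebra.adjoin ℝ (x '' Set.Icc s n) = ⊤) :
    Algebra.adjoin ℝ (x '' Set.Icc (s + 1) n) = ⊤ := by
  rw [← top_le_iff, ← hadj, Algebra.adjoin_le_iff]
  rintro _ ⟨k, ⟨hk, hkn⟩, rfl⟩
  have hmem : ∀ k, s + 1 ≤ k → k ≤ n → x k ∈ Algebra.adjoin ℝ (x '' Set.Icc (s + 1) n) :=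
    fun k h1 h2 => Algebra.subset_adjoin ⟨k, ⟨h1, h2⟩, rfl⟩
  rcases hk.eq_or_lt with rfl | hk
  · rcases hx with hx | hx <;> rw [SetLike.mem_coe, hx]
    · exact hmem l hl hln
    · exact neg_mem (hmem l hl hln)
  · exact hmem k hk hkn

theorem RowSystem.merge {A : Type*} [CommRing A] [Algebra ℝ A] {n s l : ℕ} {h : ℕ → ℕ}
    {x : ℕ → A} {u : ℕ → ℝ} {j : ℕ} (H : RowSystem n s h x u j) (hl : s + 1 ≤ l) (hln : l ≤ n)
    (hx : x s = x l ∨ x s = -x l)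
    (hlt : ∀ i, s + 1 ≤ i → i < l → rowTerm x n i (h i) (x s) = 0)
    (hge : ∀ i, l ≤ i → i < n → rowTerm x n i (h i) (x s) = rowTerm x n i (h i) (x l)) :
    RowSystem n (s + 1) h x (fun k => u k + if k = l then u s else 0)
      (if j = s then l else j) := by
  have hI : ∀ i, s ≤ i → Finset.Icc s i = insert s (Finset.Icc (s + 1) i) := by
    intro i hi; ext k; simp only [Finset.mem_insert, Finset.mem_Icc]; omega
  have hj := H.le_j
  have hjn := H.j_le
  refine ⟨by split_ifs <;> omega, by split_ifs <;> omega, ?_, ?_, ?_, ?_, ?_⟩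
  · split_ifs with h1
    · have h0 := H.zero
      rw [h1] at h0
      rcases hx with hx | hx <;> rw [h0] at hx
      · exact hx.symm
      · exact neg_eq_zero.1 hx.symm
    · exact H.zero
  · intro k hk hkn hkj
    have hs := H.pos s le_rfl (by omega)
    have hk' := H.pos k (by omega) hkn
    split_ifs at hkj with h1
    · simp only [hkj, if_false, add_zero]
      exact hk' (by omega)
    · have h2 := hs (fun h => h1 h.symm)
      have h3 := hk' hkj
      split_ifs <;> linarith
  · have h0 := H.sum
    rw [hI n (by omega), Finset.sum_insert (by simp)] at h0
    rw [Finset.sum_add_distrib, Finset.sum_ite_eq' (Finset.Icc (s + 1) n),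
      if_pos (Finset.mem_Icc.2 ⟨hl, hln⟩)]
    linarith
  · exact adjoin_eq_top_of_mem hl hln hx H.adjoin
  · intro i hi hin
    have h0 := H.rel i (by omega) hin
    rw [hI i (by omega), Finset.sum_insert (by simp)] at h0
    simp only [add_smul, ite_smul, zero_smul]
    rw [Finset.sum_add_distrib, Finset.sum_ite_eq' (Finset.Icc (s + 1) i)]
    by_cases hil : l ≤ i
    · rw [if_pos (Finset.mem_Icc.2 ⟨hl, hil⟩), ← hge i hil hin, add_comm]
      exact h0
    · rw [hlt i hi (by omega), smul_zero, zero_add] at h0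
      rw [if_neg (by simp [hil]), add_zero]
      exact h0

theorem RowSystem.map_mk {A : Type*} [CommRing A] [Algebra ℝ A] {n s : ℕ} {h : ℕ → ℕ}
    {x : ℕ → A} {u : ℕ → ℝ} {j : ℕ} (H : RowSystem n s h x u j) (K : Ideal A) :
    RowSystem n s h (fun k => Ideal.Quotient.mk K (x k)) u j := by
  refine ⟨H.le_j, H.j_le, by simp [H.zero], H.pos, H.sum,
    adjoin_image_quotient_eq_top H.adjoin K, fun i hi hin => ?_⟩
  have h0 := congrArg (Ideal.Quotient.mkₐ ℝ K) (H.rel i hi hin)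
  simp only [map_sum, map_smul, map_zero, Ideal.Quotient.mkₐ_eq_mk, map_rowTerm] at h0
  exact h0

theorem span_eq_top_of_adjoin_zero {A : Type*} [CommRing A] [Algebra ℝ A] {S : Set A}
    (hS : ∀ a ∈ S, a = 0) (hadj : Algebra.adjoin ℝ S = ⊤) {T : Set A} (hT : (1 : A) ∈ T) :
    Submodule.span ℝ T = ⊤ := by
  have hbot : Algebra.adjoin ℝ S ≤ ⊥ :=
    Algebra.adjoin_le_iff.2 fun a ha => by rw [hS a ha]; exact zero_mem _
  refine Submodule.eq_top_iff'.2 fun z => ?_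
  have hz : z ∈ (⊥ : Subalgebra ℝ A) := hbot (hadj ▸ Algebra.mem_top)
  obtain ⟨r, rfl⟩ := Algebra.mem_bot.1 hz
  rw [Algebra.algebraMap_eq_smul_one]
  exact Submodule.smul_mem _ _ (Submodule.subset_span hT)

theorem RowSystem.span_rowProducts {n : ℕ} {h : ℕ → ℕ} (d : ℕ) : ∀ {s : ℕ}, s + d = n →
    (∀ i, s ≤ i → i < n → n ≤ h i) → (∀ i, s ≤ i → i < n → h i + i + 1 ≤ 2 * n) →
    (∀ i, s ≤ i → i + 1 < n → h i ≤ h (i + 1) ∨ h (i + 1) + i + 2 = 2 * n) →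
    ∀ {A : Type v} [CommRing A] [Algebra ℝ A] {x : ℕ → A} {u : ℕ → ℝ} {j : ℕ},
    RowSystem n s h x u j → Submodule.span ℝ (rowProducts n s h x) = ⊤ := by
  induction d with
  | zero =>
    intro s hs _ _ _ A _ _ x u j H
    obtain rfl : s = n := hs
    obtain rfl : j = s := le_antisymm H.j_le H.le_j
    refine span_eq_top_of_adjoin_zero ?_ H.adjoin ⟨id, by intros; omega, by simp⟩
    rintro _ ⟨k, ⟨hk, hk'⟩, rfl⟩
    rw [le_antisymm hk' hk]; exact H.zero
  | succ d ih =>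
    intro s hs hlow hmax hstep A _ _ x u j H
    have hsn : s < n := by omega
    have hhs := hlow s le_rfl hsn
    have hhs' := hmax s le_rfl hsn
    set W := Submodule.span ℝ (rowProducts n s h x)
    set P : ℕ → A := fun p => ∏ q ∈ Finset.Ioc p (h s), colFactor x n q (x s) with hP
    have top_of_merge : ∀ p l, s ≤ p → p ≤ h s → s + 1 ≤ l → l ≤ n →
        ∀ y : ℕ → A ⧸ absorb W (P p), y = (fun k => Ideal.Quotient.mk _ (x k)) →
        (y s = y l ∨ y s = -y l) →
        (∀ i, s + 1 ≤ i → i < l → rowTerm y n i (h i) (y s) = 0) →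
        (∀ i, l ≤ i → i < n → rowTerm y n i (h i) (y s) = rowTerm y n i (h i) (y l)) →
        absorb W (P p) = ⊤ := by
      intro p l hsp hps hl hln y hy hx hlt hge
      have hM := H.map_mk (absorb W (P p))
      rw [← hy] at hM
      refine absorb_eq_top_of_span_quotient _ (ih (by omega) (fun i hi => hlow i (by omega))
        (fun i hi => hmax i (by omega)) (fun i hi => hstep i (by omega))
        (hM.merge hl hln hx hlt hge)) ?_
      rintro _ ⟨L, hL, rfl⟩
      refine ⟨∏ i ∈ Finset.Ico (s + 1) n, ∏ p ∈ Finset.Ioc (L i) (h i), colFactor x n p (x i),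
        by simp [map_prod, map_colFactor, hy], Submodule.subset_span
          ⟨Function.update L s p, ?_, ?_⟩⟩
      · intro i hi hin
        rcases eq_or_ne i s with rfl | his
        · simp [hsp, hps]
        · rw [Function.update_of_ne his]
          exact hL i (by omega) hin
      · rw [Finset.prod_eq_prod_Ico_succ_bot hsn, Function.update_self]
        congr 1
        refine Finset.prod_congr rfl fun i hi => ?_
        rw [Function.update_of_ne]
        have := Finset.mem_Ico.1 hi
        omega
    have hu : u s ≠ 0 := by
      by_cases hjs : j = s
      · have hpos : 0 < ∑ k ∈ Finset.Icc (s + 1) n, u k :=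
          Finset.sum_pos (fun k hk => by
            have := Finset.mem_Icc.1 hk
            exact H.pos k (by omega) (by omega) (by omega)) ⟨n, by simp; omega⟩
        have h0 := H.sum
        have hI : Finset.Icc s n = insert s (Finset.Icc (s + 1) n) := by
          ext k; simp only [Finset.mem_insert, Finset.mem_Icc]; omega
        rw [hI, Finset.sum_insert (by simp)] at h0
        intro h1
        linarith
      · exact (H.pos s le_rfl hsn.le (Ne.symm hjs)).ne'
    have key : ∀ p, s ≤ p → p ≤ h s → absorb W (P p) = ⊤ := by
      intro p hsp
      induction p, hsp using Nat.le_induction with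
      | base =>
        intro _
        have h0 := H.rel s le_rfl hsn
        rw [Finset.Icc_self, Finset.sum_singleton, smul_eq_zero_iff_right hu, rowTerm,
          if_neg (by omega)] at h0
        have hmem : x s + x n ∈ absorb W (P s) :=
          mem_absorb_of_mul_eq_zero (by rw [mul_comm]; exact h0)
        have hadd : Ideal.Quotient.mk (absorb W (P s)) (x s) +
            Ideal.Quotient.mk (absorb W (P s)) (x n) = 0 := by
          rw [← map_add]; exact Ideal.Quotient.eq_zero_iff_mem.2 hmem
        refine top_of_merge s n le_rfl (by omega) hsn le_rfl _ rfl
          (Or.inr (eq_neg_of_add_eq_zero_left hadd)) (fun i hi hin => ?_) (by intros; omega)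
        exact rowTerm_eq_zero_of_add (by have := hlow i (by omega) hin; omega) hadd
      | succ p hsp ihp =>
        intro hp
        have hmem : colFactor x n (p + 1) (x s) ∈ absorb W (P (p + 1)) := by
          refine mem_absorb_of_absorb_mul_eq_top ?_
          have h0 := ihp (by omega)
          have hI : Finset.Ioc p (h s) = insert (p + 1) (Finset.Ioc (p + 1) (h s)) := by
            ext k; simp only [Finset.mem_insert, Finset.mem_Ioc]; omega
          simp only [hP] at h0 ⊢
          rwa [hI, Finset.prod_insert (by simp), mul_comm] at h0
        have hz := Ideal.Quotient.eq_zero_iff_mem.2 hmem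
        rw [map_colFactor] at hz
        by_cases hpn : p + 1 ≤ n
        · have hx := hz
          rw [colFactor, if_pos hpn, sub_eq_zero] at hx
          refine top_of_merge (p + 1) (p + 1) (by omega) hp (by omega) hpn _ rfl (Or.inl hx)
            (fun i hi hin => ?_) (fun i _ _ => by rw [hx])
          have := hlow i (by omega) (by omega)
          exact rowTerm_eq_zero_of_colFactor (p := p + 1) hin (by omega) hz
        · have hx := hz
          rw [colFactor, if_neg hpn] at hx
          have hx := eq_neg_of_add_eq_zero_left hx
          refine top_of_merge (p + 1) (2 * n - (p + 1)) (by omega) hp (by omega) (by omega) _ rfl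
            (Or.inr hx) (fun i hi hil => ?_) (fun i hil hin => ?_)
          · have := le_or_eq_max_of_step hmax hstep le_rfl (show s ≤ i by omega) (by omega)
            exact rowTerm_eq_zero_of_colFactor (p := p + 1) (by omega) (by omega) hz
          · have := le_or_eq_max_of_step hmax hstep le_rfl (show s ≤ i by omega) (by omega)
            have := hmax i (by omega) hin
            rw [hx]
            exact rowTerm_neg hin (by omega)
    refine eq_top_of_absorb_one_eq_top ?_
    have h1 := key (h s) (by omega) le_rfl
    simpa [hP] using h1

end EvenSpan

section Labels

variable {n : ℕ} {ℓ ℓ' : ℕ → ℤ}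

theorem dStage_succ_eq (n : ℕ) (ℓ : ℕ → ℤ) (s : ℕ) :
    dStage n ℓ (s + 1) =
      if (dStepLabel n ℓ).isSome then dStage (n - 1) (dStepVec n ℓ) s else none := by
  induction s with
  | zero => simp [dStage]
  | succ s ih =>
    rw [dStage, ih]
    split_ifs
    · rw [dStage, Nat.sub_sub, Nat.add_comm 1 s]
    · rfl

theorem dLabelAt_one (n : ℕ) (ℓ : ℕ → ℤ) : dLabelAt n ℓ 1 = dStepLabel n ℓ := by
  simp [dLabelAt, dStage]

theorem dLabelAt_succ (n : ℕ) (ℓ : ℕ → ℤ) {s : ℕ} (hs : 1 ≤ s) :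
    dLabelAt n ℓ (s + 1) =
      if (dStepLabel n ℓ).isSome then dLabelAt (n - 1) (dStepVec n ℓ) s else none := by
  obtain ⟨s, rfl⟩ := Nat.exists_eq_add_of_le' hs
  rw [dLabelAt, Nat.add_sub_cancel, dStage_succ_eq]
  split_ifs
  · simp only [dLabelAt, Nat.add_sub_cancel, Nat.sub_sub, Nat.add_comm 1 s]
  · rfl

theorem dLabelAt_congr {s : ℕ} (hs : 1 ≤ s) (hsn : s ≤ n)
    (h : ∀ i, 1 ≤ i → i ≤ n → ℓ i = ℓ' i) : dLabelAt n ℓ s = dLabelAt n ℓ' s := by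
  induction s, hs using Nat.le_induction generalizing n ℓ ℓ' with
  | base =>
    rw [dLabelAt_one, dLabelAt_one, dStepLabel, dStepLabel, h n hsn le_rfl, h 1 le_rfl hsn]
  | succ s hs ih =>
    have h1 : dStepLabel n ℓ = dStepLabel n ℓ' := by
      rw [dStepLabel, dStepLabel, h n (by omega) le_rfl, h 1 le_rfl (by omega)]
    rw [dLabelAt_succ n ℓ hs, dLabelAt_succ n ℓ' hs, h1, ih (by omega)]
    intro i hi hin
    rw [dStepVec, dStepVec, h n (by omega) le_rfl, h 1 le_rfl (by omega),
      h (i + 1) (by omega) (by omega)]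

theorem dLabelAt_eq_of_add_le {s : ℕ} (hs : 1 ≤ s) (hℓ : (s : ℤ) + ℓ n ≤ 2 * n - 1) :
    dLabelAt n ℓ s = some DLabel.r1 ∨ dLabelAt n ℓ s = some DLabel.r3 := by
  induction s, hs using Nat.le_induction generalizing n ℓ with
  | base =>
    rw [dLabelAt_one, dStepLabel, if_pos (by push_cast at hℓ; linarith)]
    split_ifs <;> simp
  | succ s hs ih =>
    push_cast at hℓ
    have hlt : ℓ n < 2 * (n : ℤ) - 1 := by omega
    have hsome : (dStepLabel n ℓ).isSome := by
      rw [dStepLabel, if_pos hlt]; split_ifs <;> rfl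
    rw [dLabelAt_succ n ℓ hs, if_pos hsome]
    refine ih ?_
    rw [dStepVec, if_pos rfl, if_neg (by omega)]
    rcases Nat.eq_zero_or_pos n with rfl | hn
    · push_cast at *
      omega
    · push_cast [hn]
      omega

theorem dLabelAt_eq_none {s : ℕ} (hs : 1 ≤ s) (h1 : (n : ℤ) ≤ ℓ 1) (hn : ℓ n = 2 * n - 1) :
    dLabelAt n ℓ s = none := by
  have h0 : dStepLabel n ℓ = none := by
    rw [dStepLabel, if_neg (by omega), if_neg (by omega)]
  rcases hs.eq_or_lt with rfl | hs
  · rw [dLabelAt_one, h0]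
  · obtain ⟨s, rfl⟩ := Nat.exists_eq_add_of_le' hs
    rw [dLabelAt_succ n ℓ (by omega), h0]
    rfl

variable {A : Type*} [CommRing A]

theorem map_alDMod {B : Type*} [CommRing B] (q : A →+* B) (x : ℕ → A) (i j : ℕ) :
    q (alDMod x n ℓ i j) = alDMod (fun k => q (x k)) n ℓ i j := by
  unfold alDMod alD; split_ifs <;> simp

theorem alDMod_congr (x : ℕ → A) {i j : ℕ} (hi : 1 ≤ i) (hin : i ≤ n) (hij : i < j)
    (hj : i = n → j < 2 * n) (h : ∀ i, 1 ≤ i → i ≤ n → ℓ i = ℓ' i) :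
    alDMod x n ℓ i j = alDMod x n ℓ' i j := by
  unfold alDMod
  by_cases h0 : i = n
  · rw [if_pos h0, if_pos h0, dLabelAt_congr (by have := hj h0; omega) (by omega) h]
  · rw [if_neg h0, if_neg h0, dLabelAt_congr hi hin h,
      dLabelAt_congr (s := n - j + i) (by omega) (by omega) h]

theorem alDMod_eq_alD (x : ℕ → A) {i j : ℕ} (hi : i ≠ n)
    (h : dLabelAt n ℓ i ≠ some DLabel.r2) : alDMod x n ℓ i j = alD x n i j := by
  simp [alDMod, hi, h]

theorem alDMod_eq_alD_of_le (x : ℕ → A) {i j : ℕ} (hi : i ≠ n) (hj : n ≤ j) :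
    alDMod x n ℓ i j = alD x n i j := by
  have h0 : ¬ i < n - j + i := by omega
  simp [alDMod, hi, h0]

/-- The variables `x_2, x_3, …`, preceded by `0`. -/
def shiftVar (x : ℕ → A) : ℕ → A := fun k => if k = 0 then 0 else x (k + 1)

theorem alDMod_succ_succ (x : ℕ → A) {i j : ℕ} (hi : 1 ≤ i) (hij : i < j)
    (hj : j + 3 ≤ 2 * n) (hsome : (dStepLabel n ℓ).isSome) :
    alDMod x n ℓ (i + 1) (j + 1) = alDMod (shiftVar x) (n - 1) (dStepVec n ℓ) i j := by
  unfold alDMod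
  by_cases h0 : i + 1 = n
  · have h1 : 2 * n - (j + 1) = 2 * (n - 1) - j + 1 := by omega
    have h2 : 2 * (n - 1) - j ≠ 0 := by omega
    have h3 : n - 1 ≠ 0 := by omega
    rw [if_pos h0, if_pos (show i = n - 1 by omega), h1, dLabelAt_succ n ℓ (by omega), if_pos hsome]
    simp only [shiftVar, h2, h3, if_false, Nat.sub_add_cancel (show 1 ≤ n by omega)]
  · have h1 : n - (j + 1) + (i + 1) = n - 1 - j + i + 1 := by omega
    have h2 : n - 1 - j + i ≠ 0 := by omega
    have h3 : i ≠ 0 := by omega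
    have h4 : j ≠ 0 := by omega
    have h5 : i ≠ n - 1 := by omega
    have h6 : alD x n (i + 1) (j + 1) = alD (shiftVar x) (n - 1) i j := by
      unfold alD
      have h7 : j + 1 ≤ n ↔ j ≤ n - 1 := by omega
      have h8 : 2 * n - (j + 1) = 2 * (n - 1) - j + 1 := by omega
      have h9 : 2 * (n - 1) - j ≠ 0 := by omega
      simp only [h0, h5, h7, h8, h9, h3, h4, if_false, shiftVar]
    rw [if_neg h0, if_neg h5, h1, dLabelAt_succ n ℓ hi,
      dLabelAt_succ n ℓ (s := n - 1 - j + i) (by omega), if_pos hsome, if_pos hsome, h6]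
    simp only [shiftVar, h2, h3, if_false, Nat.add_lt_add_iff_right]

end Labels

section Products

variable {A : Type*} [CommRing A] {n : ℕ} {h : ℕ → ℕ}

/-- The shape conditions on a Hessenberg function of type `D_n`. -/
structure HessD (n : ℕ) (h : ℕ → ℕ) : Prop where
  le : ∀ i, 1 ≤ i → i < n → i ≤ h i
  max : ∀ i, 1 ≤ i → i < n → h i + i + 1 ≤ 2 * n
  le_last : n ≤ h n
  last_le : h n + 1 ≤ 2 * n
  step : ∀ i, 1 ≤ i → i + 1 < n → h i ≤ h (i + 1) ∨ h (i + 1) + i + 2 = 2 * n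
  last_ge : ∀ i, 1 ≤ i → i + 1 < n → n + 1 ≤ h i → 2 * n ≤ h n + i
  ge_of_last : ∀ i, 1 ≤ i → i + 1 < n → 2 * n ≤ h n + i → n ≤ h i + 1

/-- The Hessenberg function obtained by deleting the first row. -/
def tailHess (n : ℕ) (h : ℕ → ℕ) : ℕ → ℕ := fun i =>
  if i = n - 1 then min (h n) (2 * n - 2) - 1 else h (i + 1) - 1

theorem HessD.tail (H : HessD n h) (hn : 2 ≤ n) : HessD (n - 1) (tailHess n h) := by
  have a := H.le_last
  have b := H.last_le
  constructor
  · intro i hi hin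
    have := H.le (i + 1) (by omega) (by omega)
    simp only [tailHess]; split_ifs <;> omega
  · intro i hi hin
    have := H.le (i + 1) (by omega) (by omega)
    have := H.max (i + 1) (by omega) (by omega)
    simp only [tailHess]; split_ifs <;> omega
  · simp only [tailHess, if_true]; omega
  · simp only [tailHess, if_true]; omega
  · intro i hi hin
    have := H.step (i + 1) (by omega) (by omega)
    have := H.le (i + 1 + 1) (by omega) (by omega)
    simp only [tailHess]; split_ifs <;> omega
  · intro i hi hin
    have := H.last_ge (i + 1) (by omega) (by omega)
    simp only [tailHess, if_true]; split_ifs <;> omega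
  · intro i hi hin
    have := H.ge_of_last (i + 1) (by omega) (by omega)
    simp only [tailHess, if_true]; split_ifs <;> omega

/-- The product of modified roots attached to the vector `L`. -/
def rootProd (x : ℕ → A) (n : ℕ) (h L : ℕ → ℕ) : A :=
  ∏ i ∈ Finset.Icc 1 n, ∏ p ∈ Finset.Ioc (L i) (h i), alDMod x n (fun r => (L r : ℤ)) i p

/-- The set of all products of modified roots below `h`. -/
def rootProducts (x : ℕ → A) (n : ℕ) (h : ℕ → ℕ) : Set A :=
  {v | ∃ L : ℕ → ℕ, (∀ i, 1 ≤ i → i ≤ n → i ≤ L i ∧ L i ≤ h i) ∧ v = rootProd x n h L}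

theorem rootProd_eq_first_mul (x : ℕ → A) (hn : 2 ≤ n) (h L : ℕ → ℕ) :
    rootProd x n h L =
      (∏ p ∈ Finset.Ioc (L 1) (h 1), alDMod x n (fun r => (L r : ℤ)) 1 p) *
      ((∏ i ∈ Finset.Ico 2 n, ∏ p ∈ Finset.Ioc (L i) (h i),
        alDMod x n (fun r => (L r : ℤ)) i p) *
      ∏ p ∈ Finset.Ioc (L n) (h n), alDMod x n (fun r => (L r : ℤ)) n p) := by
  have hI : Finset.Icc 1 n = insert 1 (insert n (Finset.Ico 2 n)) := by
    ext k; simp only [Finset.mem_insert, Finset.mem_Icc, Finset.mem_Ico]; omega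
  rw [rootProd, hI, Finset.prod_insert (by simp; omega), Finset.prod_insert (by simp)]
  ring

theorem map_rootProd {B : Type*} [CommRing B] (q : A →+* B) (x : ℕ → A) (n : ℕ) (h L : ℕ → ℕ) :
    q (rootProd x n h L) = rootProd (fun k => q (x k)) n h L := by
  simp [rootProd, map_prod, map_alDMod]

theorem shiftVar_map {B : Type*} [CommRing B] (q : A →+* B) (x : ℕ → A) :
    shiftVar (fun k => q (x k)) = fun k => q (shiftVar x k) := by
  funext k; simp only [shiftVar]; split_ifs <;> simp

theorem prod_Ioc_pred {a b : ℕ} (ha : 1 ≤ a) (f : ℕ → A) :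
    ∏ p ∈ Finset.Ioc (a - 1) (b - 1), f p = ∏ p ∈ Finset.Ioc a b, f (p - 1) := by
  refine Finset.prod_bij' (fun p _ => p + 1) (fun p _ => p - 1) ?_ ?_ ?_ ?_ ?_ <;>
    intro p hp <;> simp only [Finset.mem_Ioc, Nat.add_sub_cancel] at hp ⊢ <;> omega

theorem prod_Ico_two {n : ℕ} (hn : 2 ≤ n) (f : ℕ → A) :
    ∏ i ∈ Finset.Ico 2 n, f i = ∏ i ∈ Finset.Ico 1 (n - 1), f (i + 1) := by
  have := Finset.prod_Ico_add' f 1 (n - 1) 1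
  rw [this, Nat.sub_add_cancel (by omega)]

theorem prod_Icc_one_eq {n : ℕ} (hn : 1 ≤ n) (f : ℕ → A) :
    ∏ i ∈ Finset.Icc 1 n, f i = (∏ i ∈ Finset.Ico 1 n, f i) * f n := by
  rw [← Finset.prod_Ico_succ_top hn]; rfl

/-- Rows `2, …, n-1` of the product attached to `L` agree with the rows of the reduced product. -/
theorem prod_middle_eq (x : ℕ → A) (H : HessD n h) (hn : 2 ≤ n) {L L' : ℕ → ℕ}
    (hLL : ∀ i, 1 ≤ i → i ≤ n - 1 → dStepVec n (fun r => (L r : ℤ)) i = L' i)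
    (hL1 : ∀ i, 1 ≤ i → i < n - 1 → L (i + 1) = L' i + 1)
    (hL' : ∀ i, 1 ≤ i → i ≤ n - 1 → i ≤ L' i)
    (hsome : (dStepLabel n (fun r => (L r : ℤ))).isSome) :
    ∏ i ∈ Finset.Ico 2 n, ∏ p ∈ Finset.Ioc (L i) (h i), alDMod x n (fun r => (L r : ℤ)) i p =
      ∏ i ∈ Finset.Ico 1 (n - 1), ∏ p ∈ Finset.Ioc (L' i) (tailHess n h i),
        alDMod (shiftVar x) (n - 1) (fun r => (L' r : ℤ)) i p := by
  rw [prod_Ico_two hn]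
  refine Finset.prod_congr rfl fun i hi => ?_
  obtain ⟨hi1, hi2⟩ := Finset.mem_Ico.1 hi
  have hL1' := hL1 i hi1 hi2
  have hLi := hL' i hi1 (by omega)
  have hmax := H.max (i + 1) (by omega) (by omega)
  rw [tailHess, if_neg (by omega), show L' i = L (i + 1) - 1 by omega, prod_Ioc_pred (by omega)]
  refine Finset.prod_congr rfl fun p hp => ?_
  obtain ⟨hp1, hp2⟩ := Finset.mem_Ioc.1 hp
  have hs := alDMod_succ_succ x (ℓ := fun r => (L r : ℤ)) (n := n) (i := i) (j := p - 1) hi1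
    (by omega) (by omega) hsome
  rw [Nat.sub_add_cancel (by omega)] at hs
  rw [hs]
  exact alDMod_congr _ hi1 (by omega) (by omega) (by omega) hLL

/-- Lifting reduced products through a step labelled `(1r)` or `(3r)`. -/
theorem mul_rootProd_mem_of_lt (x : ℕ → A) (H : HessD n h) (hn : 2 ≤ n) {p : ℕ} (hp : 1 ≤ p)
    (hp1 : p ≤ h 1) {v : A} (hv : v ∈ rootProducts (shiftVar x) (n - 1) (tailHess n h)) :
    (∏ q ∈ Finset.Ioc p (h 1), colFactor x n q (x 1)) *
      (v * if h n + 1 = 2 * n then (if n < p then x 1 else x 1 + x n) else 1) ∈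
      rootProducts x n h := by
  obtain ⟨L', hL', rfl⟩ := hv
  set L : ℕ → ℕ := fun i => if i = 1 then p else L' (i - 1) + 1 with hL
  have hlast := H.last_le
  have hlast' := H.le_last
  have hLn : L n = L' (n - 1) + 1 := by simp only [hL]; rw [if_neg (by omega)]
  have hL1 : L 1 = p := by simp [hL]
  have hLs : ∀ i, 1 ≤ i → L (i + 1) = L' i + 1 := fun i hi => by
    simp only [hL, Nat.add_sub_cancel]; rw [if_neg (by omega)]
  have hL'n := hL' (n - 1) (by omega) le_rfl
  have htn : tailHess n h (n - 1) = min (h n) (2 * n - 2) - 1 := by simp [tailHess]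
  rw [htn] at hL'n
  have hlt : ((L n : ℕ) : ℤ) < 2 * (n : ℤ) - 1 := by omega
  have hlab : dStepLabel n (fun r => (L r : ℤ)) =
      if n < p then some DLabel.r3 else some DLabel.r1 := by
    rw [dStepLabel, if_pos hlt, hL1]
    split_ifs <;> first | rfl | omega
  have hsome : (dStepLabel n (fun r => (L r : ℤ))).isSome := by
    rw [hlab]; split_ifs <;> rfl
  have hLL : ∀ i, 1 ≤ i → i ≤ n - 1 → dStepVec n (fun r => (L r : ℤ)) i = L' i := by
    intro i hi hin
    simp only [dStepVec]
    rw [if_neg (show ¬ (L n : ℤ) = 2 * n - 1 by omega), hLs i hi]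
    split_ifs with h0
    · rw [hLn, h0]; push_cast; ring
    · push_cast; ring
  refine ⟨L, ?_, ?_⟩
  · intro i hi hin
    rcases hi.eq_or_lt with rfl | hi
    · rw [hL1]; exact ⟨hp, hp1⟩
    · obtain ⟨i, rfl⟩ := Nat.exists_eq_add_of_le' hi
      have h1 := hL' (i + 1) (by omega) (by omega)
      rw [hLs (i + 1) (by omega)]
      rcases hin.eq_or_lt with h2 | h2
      · have h3 : i + 1 = n - 1 := by omega
        rw [h3, htn] at h1
        rw [h2, h3]
        omega
      · have h4 := H.le (i + 1 + 1) (by omega) (by omega)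
        rw [tailHess, if_neg (by omega)] at h1
        change i + 1 + 1 ≤ _ ∧ _ ≤ h (i + 1 + 1)
        omega
  · rw [rootProd_eq_first_mul x hn, hL1,
      prod_middle_eq x H hn hLL (fun i hi _ => hLs i hi) (fun i hi hin => (hL' i hi hin).1) hsome,
      rootProd, prod_Icc_one_eq (by omega)]
    have hfirst : ∏ q ∈ Finset.Ioc p (h 1), alDMod x n (fun r => (L r : ℤ)) 1 q =
        ∏ q ∈ Finset.Ioc p (h 1), colFactor x n q (x 1) :=
      Finset.prod_congr rfl fun q _ => by
        rw [alDMod_eq_alD x (by omega), alD_eq_colFactor x (by omega)]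
        rw [dLabelAt_one, hlab]
        split_ifs <;> simp
    have hend : ∏ q ∈ Finset.Ioc (L n) (min (h n) (2 * n - 2)),
          alDMod x n (fun r => (L r : ℤ)) n q =
        ∏ q ∈ Finset.Ioc (L' (n - 1)) (tailHess n h (n - 1)),
          alDMod (shiftVar x) (n - 1) (fun r => (L' r : ℤ)) (n - 1) q := by
      rw [htn, show L' (n - 1) = L n - 1 by omega, prod_Ioc_pred (by omega)]
      refine Finset.prod_congr rfl fun q hq => ?_
      obtain ⟨hq1, hq2⟩ := Finset.mem_Ioc.1 hq
      have hs := alDMod_succ_succ x (ℓ := fun r => (L r : ℤ)) (n := n) (i := n - 1) (j := q - 1)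
        (by omega) (by omega) (by omega) hsome
      rw [Nat.sub_add_cancel (by omega), Nat.sub_add_cancel (by omega)] at hs
      rw [hs]
      exact alDMod_congr _ (by omega) le_rfl (by omega) (by omega) hLL
    have hsplit : ∏ q ∈ Finset.Ioc (L n) (h n), alDMod x n (fun r => (L r : ℤ)) n q =
        (∏ q ∈ Finset.Ioc (L n) (min (h n) (2 * n - 2)), alDMod x n (fun r => (L r : ℤ)) n q) *
          if h n + 1 = 2 * n then (if n < p then x 1 else x 1 + x n) else 1 := by
      split_ifs with h0 h1
      all_goals try
        have h2 : h n = 2 * n - 2 + 1 := by omega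
        rw [min_eq_right (by omega), h2, ← Finset.prod_Ioc_consecutive _ (show L n ≤ 2 * n - 2 by
          omega) (Nat.le_succ _), Nat.Ioc_succ_singleton, Finset.prod_singleton, alDMod,
          if_pos rfl, show 2 * n - (2 * n - 2 + 1) = 1 by omega, dLabelAt_one, hlab]
        simp [h1]
      rw [min_eq_left (by omega), mul_one]
    rw [hfirst, hsplit, hend]
    ring

/-- Lifting reduced products through a step labelled `(2r)`. -/
theorem exists_mul_mem_rootProducts {B : Type*} [CommRing B] (x : ℕ → A) (H : HessD n h)
    (hn : 2 ≤ n) (h1 : n ≤ h 1 + 1) (hlast : h n + 1 = 2 * n) (q : A →+* B)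
    (hq : q (x 1) + q (x n) = 0) {v : A}
    (hv : v ∈ rootProducts (shiftVar x) (n - 1) (tailHess n h)) :
    ∃ v' e, q v = (-1) ^ e * q v' ∧
      (∏ q ∈ Finset.Ioc (n - 1) (h 1), colFactor x n q (x 1)) * v' ∈ rootProducts x n h := by
  obtain ⟨L', hL', rfl⟩ := hv
  have htn : tailHess n h (n - 1) = 2 * n - 3 := by simp [tailHess]; omega
  have hL'n := hL' (n - 1) (by omega) le_rfl
  rw [htn] at hL'n
  set L : ℕ → ℕ := fun i => if i = 1 then L' (n - 1) - (n - 2) else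
    if i = n then 2 * n - 1 else L' (i - 1) + 1 with hL
  have hLn : L n = 2 * n - 1 := by simp only [hL, if_true]; rw [if_neg (by omega)]
  have hL1 : L 1 = L' (n - 1) - (n - 2) := by simp [hL]
  have hLs : ∀ i, 1 ≤ i → i < n - 1 → L (i + 1) = L' i + 1 := fun i hi hin => by
    simp only [hL, Nat.add_sub_cancel]; rw [if_neg (by omega), if_neg (by omega)]
  have hlab : dStepLabel n (fun r => (L r : ℤ)) = some DLabel.r2 := by
    rw [dStepLabel, if_neg (by omega), if_pos (by omega)]
  have hsome : (dStepLabel n (fun r => (L r : ℤ))).isSome := by rw [hlab]; rfl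
  have hLL : ∀ i, 1 ≤ i → i ≤ n - 1 → dStepVec n (fun r => (L r : ℤ)) i = L' i := by
    intro i hi hin
    simp only [dStepVec]
    split_ifs with h0 h2
    · rw [h0]; omega
    · omega
    · rw [hLs i hi (by omega)]; push_cast; ring
  have hmid := prod_middle_eq x H hn hLL hLs (fun i hi hin => (hL' i hi hin).1) hsome
  refine ⟨(∏ p ∈ Finset.Ioc (L 1) (n - 1), alDMod x n (fun r => (L r : ℤ)) 1 p) *
    ∏ i ∈ Finset.Ico 2 n, ∏ p ∈ Finset.Ioc (L i) (h i), alDMod x n (fun r => (L r : ℤ)) i p, ?_⟩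
  have hfac : ∃ e, q (∏ p ∈ Finset.Ioc (L' (n - 1)) (tailHess n h (n - 1)),
      alDMod (shiftVar x) (n - 1) (fun r => (L' r : ℤ)) (n - 1) p) =
      (-1) ^ e * q (∏ p ∈ Finset.Ioc (L 1) (n - 1), alDMod x n (fun r => (L r : ℤ)) 1 p) := by
    have hbij : ∏ p ∈ Finset.Ioc (L' (n - 1)) (tailHess n h (n - 1)),
        alDMod (shiftVar x) (n - 1) (fun r => (L' r : ℤ)) (n - 1) p =
        ∏ p ∈ Finset.Ioc (L 1) (n - 1),
          alDMod (shiftVar x) (n - 1) (fun r => (L' r : ℤ)) (n - 1) (p + (n - 2)) := by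
      refine Finset.prod_bij' (fun p _ => p - (n - 2)) (fun p _ => p + (n - 2)) ?_ ?_ ?_ ?_ ?_
      all_goals intro p hp; simp only [Finset.mem_Ioc] at hp ⊢
      · omega
      · omega
      · omega
      · omega
      · rw [Nat.sub_add_cancel (by omega)]
    have hterm : ∀ p ∈ Finset.Ioc (L 1) (n - 1), ∃ e : ℕ,
        q (alDMod (shiftVar x) (n - 1) (fun r => (L' r : ℤ)) (n - 1) (p + (n - 2))) =
        (-1) ^ e * q (alDMod x n (fun r => (L r : ℤ)) 1 p) := by
      intro p hp
      obtain ⟨hp1, hp2⟩ := Finset.mem_Ioc.1 hp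
      have hstage : 2 * (n - 1) - (p + (n - 2)) = n - p := by omega
      have hlab' := dLabelAt_eq_of_add_le (n := n - 1) (ℓ := fun r => (L' r : ℤ)) (s := n - p)
        (by omega) (by push_cast [show 1 ≤ n by omega, show p ≤ n by omega]; omega)
      have hlabk : dLabelAt n (fun r => (L r : ℤ)) (n - p + 1) =
          dLabelAt (n - 1) (fun r => (L' r : ℤ)) (n - p) := by
        rw [dLabelAt_succ n _ (by omega), if_pos hsome]
        exact dLabelAt_congr (by omega) (by omega) hLL
      have hlt : 1 < n - p + 1 := by omega
      have hne : n - p ≠ 0 := by omega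
      have hne' : n - 1 ≠ 0 := by omega
      have h1n : 1 ≠ n := by omega
      rw [alDMod, alDMod, if_pos rfl, if_neg h1n, hlabk, dLabelAt_one, hlab, hstage]
      rcases hlab' with h0 | h0 <;> rw [h0]
      · refine ⟨1, ?_⟩
        simp only [shiftVar, hne, hne', if_false, Nat.sub_add_cancel (show 1 ≤ n by omega), hlt]
        simp [eq_neg_of_add_eq_zero_left hq]
      · refine ⟨0, ?_⟩
        simp [shiftVar, hne, hlt]
    choose! e he using hterm
    refine ⟨∑ p ∈ Finset.Ioc (L 1) (n - 1), e p, ?_⟩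
    rw [hbij, map_prod, map_prod, ← Finset.prod_pow_eq_pow_sum, ← Finset.prod_mul_distrib]
    exact Finset.prod_congr rfl he
  obtain ⟨e, he⟩ := hfac
  refine ⟨e, ?_, L, ?_, ?_⟩
  · rw [rootProd, prod_Icc_one_eq (by omega), map_mul, he, map_mul, hmid]
    ring
  · intro i hi hin
    rcases hi.eq_or_lt with rfl | hi
    · rw [hL1]; omega
    · obtain ⟨i, rfl⟩ := Nat.exists_eq_add_of_le' hi
      rcases hin.eq_or_lt with h2 | h2
      · rw [h2, hLn]
        omega
      · have h3 := hL' (i + 1) (by omega) (by omega)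
        have h4 := H.le (i + 1 + 1) (by omega) (by omega)
        rw [hLs (i + 1) (by omega) (by omega)]
        rw [tailHess, if_neg (by omega)] at h3
        change i + 1 + 1 ≤ _ ∧ _ ≤ h (i + 1 + 1)
        omega
  · rw [rootProd_eq_first_mul x hn, hLn, Finset.Ioc_eq_empty_of_le (by omega : h n ≤ 2 * n - 1),
      Finset.prod_empty, mul_one, ← Finset.prod_Ioc_consecutive _ (show L 1 ≤ n - 1 by omega)
        (show n - 1 ≤ h 1 by omega)]
    have hfirst : ∏ p ∈ Finset.Ioc (n - 1) (h 1), alDMod x n (fun r => (L r : ℤ)) 1 p =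
        ∏ p ∈ Finset.Ioc (n - 1) (h 1), colFactor x n p (x 1) :=
      Finset.prod_congr rfl fun p hp => by
        have := Finset.mem_Ioc.1 hp
        rw [alDMod_eq_alD_of_le x (by omega) (by omega), alD_eq_colFactor x (by omega)]
    rw [hfirst]
    ring

/-- When no step is defined the modified roots are the usual ones. -/
theorem mul_rowProducts_mem (x : ℕ → A) (hn : 2 ≤ n) (hlast : h n + 1 = 2 * n) {p : ℕ}
    (hp : n ≤ p) (hp1 : p ≤ h 1) {v : A} (hv : v ∈ rowProducts n 2 h x) :
    (∏ q ∈ Finset.Ioc p (h 1), colFactor x n q (x 1)) * v ∈ rootProducts x n h := by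
  obtain ⟨L', hL', rfl⟩ := hv
  set L : ℕ → ℕ := fun i => if i = 1 then p else if i = n then 2 * n - 1 else L' i with hL
  have hLn : L n = 2 * n - 1 := by simp only [hL, if_true]; rw [if_neg (by omega)]
  have hL1 : L 1 = p := by simp [hL]
  have hLs : ∀ i, 2 ≤ i → i < n → L i = L' i := fun i hi hin => by
    simp only [hL]; rw [if_neg (by omega), if_neg (by omega)]
  have hal : ∀ i q, 1 ≤ i → i < n →
      alDMod x n (fun r => (L r : ℤ)) i q = colFactor x n q (x i) := fun i q hi hin => by
    rw [alDMod_eq_alD x (by omega), alD_eq_colFactor x (by omega)]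
    rw [dLabelAt_eq_none hi (by rw [hL1]; exact_mod_cast hp) (by rw [hLn]; omega)]
    simp
  refine ⟨L, fun i hi hin => ?_, ?_⟩
  · rcases hi.eq_or_lt with rfl | hi
    · rw [hL1]; omega
    · rcases hin.eq_or_lt with rfl | hin
      · rw [hLn]; omega
      · rw [hLs i hi hin]; exact hL' i hi hin
  · rw [rootProd_eq_first_mul x hn, hLn, Finset.Ioc_eq_empty_of_le (by omega : h n ≤ 2 * n - 1),
      Finset.prod_empty, mul_one, hL1]
    congr 1
    · exact Finset.prod_congr rfl fun q _ => (hal 1 q le_rfl (by omega)).symm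
    · refine Finset.prod_congr rfl fun i hi => ?_
      obtain ⟨hi1, hi2⟩ := Finset.mem_Ico.1 hi
      rw [hLs i hi1 hi2]
      exact Finset.prod_congr rfl fun q _ => (hal i q (by omega) hi2).symm

theorem rowTerm_shiftVar {x : ℕ → A} {i j : ℕ} (hn : 3 ≤ n) (hj : j + 3 ≤ 2 * n) (t : A) :
    rowTerm (shiftVar x) (n - 1) i j t = rowTerm x n (i + 1) (j + 1) t := by
  unfold rowTerm
  congr 1
  · have h1 : j ≤ n - 1 - 2 ↔ j + 1 ≤ n - 2 := by omega
    simp only [h1, shiftVar, show n - 1 ≠ 0 by omega, if_false,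
      Nat.sub_add_cancel (show 1 ≤ n by omega)]
  · have h2 := prod_Ioc_pred (a := i + 1) (b := j + 1) (by omega)
      (fun p => colFactor (shiftVar x) (n - 1) p t)
    simp only [Nat.add_sub_cancel] at h2
    rw [h2]
    refine Finset.prod_congr rfl fun p hp => ?_
    obtain ⟨hp1, hp2⟩ := Finset.mem_Ioc.1 hp
    have h3 : p - 1 ≤ n - 1 ↔ p ≤ n := by omega
    have h4 : 2 * (n - 1) - (p - 1) + 1 = 2 * n - p := by omega
    simp only [colFactor, h3, shiftVar, h4, show p - 1 ≠ 0 by omega,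
      show 2 * (n - 1) - (p - 1) ≠ 0 by omega, if_false, Nat.sub_add_cancel (show 1 ≤ p by omega)]

theorem lastTerm_shiftVar {x : ℕ → A} (s : ℕ) (t : A) :
    lastTerm (shiftVar x) (n - 1) s t = lastTerm x n (s + 1) t := by
  unfold lastTerm
  have h2 := prod_Ioc_pred (a := s + 1) (b := n) (by omega) (fun p => t - shiftVar x p)
  rw [Nat.add_sub_cancel] at h2
  rw [h2]
  refine Finset.prod_congr rfl fun p hp => ?_
  obtain ⟨hp1, hp2⟩ := Finset.mem_Ioc.1 hp
  simp only [shiftVar, show p - 1 ≠ 0 by omega, if_false, Nat.sub_add_cancel (show 1 ≤ p by omega)]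

/-- The weights after identifying `x_1` with `± x_{u+1}` (or with `0` if `u = 0`). -/
def mergeWeight (w : ℕ → ℝ) (u : ℕ) : ℕ → ℝ := fun k =>
  (if k = 0 then w 0 else w (k + 1)) + if k = u then w 1 else 0

theorem sum_mergeWeight {x : ℕ → A} {w : ℕ → ℝ} (hx : x 0 = 0) {M : Type*}
    [AddCommGroup M] [Module ℝ M] (F : A → M)
    {u i : ℕ} (hlt : i < u → F (x 1) = 0) (hge : u ≤ i → F (x 1) = F (shiftVar x u)) :
    ∑ k ∈ Finset.range (i + 1), mergeWeight w u k • F (shiftVar x k) =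
      ∑ k ∈ Finset.range (i + 2), w k • F (x k) := by
  simp only [mergeWeight, add_smul, ite_smul, zero_smul]
  rw [Finset.sum_add_distrib, Finset.sum_ite_eq', Finset.sum_range_succ', Finset.sum_range_succ',
    Finset.sum_range_succ']
  have h1 : (if u ∈ Finset.range (i + 1) then w 1 • F (shiftVar x u) else 0) =
      w 1 • F (x 1) := by
    split_ifs with h0
    · rw [hge (by simpa [Nat.lt_succ_iff] using h0)]
    · rw [hlt (by simpa using h0), smul_zero]
  rw [h1]
  simp only [shiftVar, hx, Nat.add_eq_zero_iff, one_ne_zero, and_false, if_false, if_true]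
  abel

end Products

section Merge

universe v

variable {A : Type v} [CommRing A] [Algebra ℝ A] {n : ℕ} {h : ℕ → ℕ} {x : ℕ → A} {w : ℕ → ℝ}

/-- The weighted relations attached to the rows `i < n`. -/
structure RowRelations (n : ℕ) (h : ℕ → ℕ) (x : ℕ → A) (w : ℕ → ℝ) : Prop where
  zero : x 0 = 0
  adjoin : Algebra.adjoin ℝ (x '' Set.Icc 1 n) = ⊤
  pos : ∀ k, 1 ≤ k → k ≤ n → 0 < w k
  sum : ∑ k ∈ Finset.range (n + 1), w k = 0
  row : ∀ i, 1 ≤ i → i < n →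
    ∑ k ∈ Finset.range (i + 1), w k • rowTerm x n i (h i) (x k) = 0

/-- The weighted relations attached to all rows. -/
structure RootRelations (n : ℕ) (h : ℕ → ℕ) (x : ℕ → A) (w : ℕ → ℝ) : Prop
    extends RowRelations n h x w where
  last : ∀ r, r + h n + 1 ≤ 2 * n →
    ∑ k ∈ Finset.range (r + 1), w k • lastTerm x n r (x k) = 0

theorem RowRelations.map_mk (R : RowRelations n h x w) (K : Ideal A) :
    RowRelations n h (fun k => Ideal.Quotient.mk K (x k)) w := by
  refine ⟨by simp [R.zero], adjoin_image_quotient_eq_top R.adjoin K, R.pos, R.sum,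
    fun i hi hin => ?_⟩
  have h0 := congrArg (Ideal.Quotient.mkₐ ℝ K) (R.row i hi hin)
  simp only [map_sum, map_smul, map_zero, Ideal.Quotient.mkₐ_eq_mk, map_rowTerm] at h0
  exact h0

theorem RowRelations.weight_zero_ne (R : RowRelations n h x w) (hn : 1 ≤ n) : w 0 ≠ 0 := by
  have h0 := R.sum
  rw [Finset.sum_range_succ'] at h0
  have hpos : 0 < ∑ k ∈ Finset.range n, w (k + 1) :=
    Finset.sum_pos (fun k hk => R.pos _ (by omega) (by have := Finset.mem_range.1 hk; omega))
      ⟨0, by simp; omega⟩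
  intro h1
  linarith

theorem RowRelations.merge (R : RowRelations n h x w) (H : HessD n h) (hn : 2 ≤ n) {u : ℕ}
    (hu : u + 1 ≤ n) (hx : x 1 = shiftVar x u ∨ x 1 = -shiftVar x u)
    (hlt : ∀ i, 2 ≤ i → i < n → i ≤ u → rowTerm x n i (h i) (x 1) = 0)
    (hge : ∀ i, 2 ≤ i → i < n → u < i →
      rowTerm x n i (h i) (x 1) = rowTerm x n i (h i) (shiftVar x u)) :
    RowRelations (n - 1) (tailHess n h) (shiftVar x) (mergeWeight w u) := by
  refine ⟨by simp [shiftVar], ?_, ?_, ?_, ?_⟩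
  · rw [← top_le_iff, ← R.adjoin, Algebra.adjoin_le_iff]
    rintro _ ⟨k, ⟨hk, hkn⟩, rfl⟩
    have hmem : ∀ k, k + 1 ≤ n →
        shiftVar x k ∈ Algebra.adjoin ℝ (shiftVar x '' Set.Icc 1 (n - 1)) := by
      intro k hkn
      rcases Nat.eq_zero_or_pos k with rfl | hk
      · simp [shiftVar]
      · exact Algebra.subset_adjoin ⟨k, ⟨hk, by omega⟩, rfl⟩
    rcases hk.eq_or_lt with rfl | hk
    · rcases hx with hx | hx <;> rw [SetLike.mem_coe, hx]
      · exact hmem u hu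
      · exact neg_mem (hmem u hu)
    · have h1 := hmem (k - 1) (by omega)
      rwa [shiftVar, if_neg (by omega), Nat.sub_add_cancel (by omega)] at h1
  · intro k hk hkn
    have h1 := R.pos 1 le_rfl (by omega)
    have h2 := R.pos (k + 1) (by omega) (by omega)
    rw [mergeWeight, if_neg (by omega)]
    split_ifs <;> linarith
  · have h1 := sum_mergeWeight (w := w) R.zero (fun _ : A => (1 : ℝ)) (u := u) (i := n - 1)
      (by omega) (fun _ => rfl)
    simp only [smul_eq_mul, mul_one] at h1
    rw [h1, show n - 1 + 2 = n + 1 by omega]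
    exact R.sum
  · intro i hi hin
    have hle := H.le (i + 1) (by omega) (by omega)
    have hmax := H.max (i + 1) (by omega) (by omega)
    have ht : tailHess n h i = h (i + 1) - 1 := by rw [tailHess, if_neg (by omega)]
    simp only [rowTerm_shiftVar (x := x) (i := i) (j := tailHess n h i) (show 3 ≤ n by omega)
      (by omega)]
    rw [ht, Nat.sub_add_cancel (by omega),
      sum_mergeWeight R.zero (fun t => rowTerm x n (i + 1) (h (i + 1)) t)
        (fun h0 => hlt (i + 1) (by omega) (by omega) (by omega))
        (fun h0 => hge (i + 1) (by omega) (by omega) (by omega))]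
    exact R.row (i + 1) (by omega) (by omega)

/-- The spanning property in size `n`. -/
def SpanD (n : ℕ) : Prop :=
  ∀ (h : ℕ → ℕ), HessD n h → ∀ (A : Type v) [CommRing A] [Algebra ℝ A] (x : ℕ → A) (w : ℕ → ℝ),
    RootRelations n h x w → Submodule.span ℝ (rootProducts x n h) = ⊤

theorem RowRelations.absorb_eq_top (R : RowRelations n h x w) (H : HessD n h) (hn : 2 ≤ n)
    (ih : SpanD.{v} (n - 1)) {W : Submodule ℝ A} {c : A} {u : ℕ} (hu : u + 1 ≤ n)
    {y : ℕ → A ⧸ absorb W c} (hy : y = fun k => Ideal.Quotient.mk (absorb W c) (x k))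
    (hx : y 1 = shiftVar y u ∨ y 1 = -shiftVar y u)
    (hlt : ∀ i, 2 ≤ i → i < n → i ≤ u → rowTerm y n i (h i) (y 1) = 0)
    (hge : ∀ i, 2 ≤ i → i < n → u < i →
      rowTerm y n i (h i) (y 1) = rowTerm y n i (h i) (shiftVar y u))
    (hlast : ∀ s, s + min (h n) (2 * n - 2) + 2 ≤ 2 * n →
      ∑ k ∈ Finset.range (s + 1), mergeWeight w u k • lastTerm y n (s + 1) (shiftVar y k) = 0)
    (hlift : ∀ v ∈ rootProducts (shiftVar x) (n - 1) (tailHess n h), ∃ v' e,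
      Ideal.Quotient.mk (absorb W c) v = (-1) ^ e * Ideal.Quotient.mk (absorb W c) v' ∧
      c * v' ∈ W) :
    absorb W c = ⊤ := by
  have hM : RowRelations n h y w := hy ▸ R.map_mk _
  have hle := H.le_last
  have htn : tailHess n h (n - 1) = min (h n) (2 * n - 2) - 1 := by simp [tailHess]
  refine absorb_eq_top_of_span_quotient _ (ih _ (H.tail hn) _ _ _
    ⟨hM.merge H hn hu hx hlt hge, fun s hs => ?_⟩) ?_
  · rw [htn] at hs
    simp only [lastTerm_shiftVar]
    exact hlast s (by omega)
  · rintro _ ⟨L, hL, rfl⟩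
    obtain ⟨v', e, he, hv'⟩ := hlift _ ⟨L, hL, rfl⟩
    refine ⟨(-1) ^ e * v', ?_, ?_⟩
    · rw [map_rootProd, ← shiftVar_map, ← hy] at he
      rw [he]; simp
    · rcases neg_one_pow_eq_or A e with h1 | h1 <;> rw [h1]
      · simpa using hv'
      · simpa using hv'

end Merge

section SpanD

universe v

variable {A : Type v} [CommRing A] [Algebra ℝ A] {n : ℕ} {h : ℕ → ℕ} {x : ℕ → A} {w : ℕ → ℝ}

/-- Elimination of the first row through steps labelled `(1r)`. -/
theorem RowRelations.absorb_eq_top_of_le (R : RowRelations n h x w) (H : HessD n h) (hn : 2 ≤ n)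
    (ih : SpanD.{v} (n - 1)) {W : Submodule ℝ A} {c : A} {b : ℕ} (hb : 1 ≤ b) (hbn : b ≤ n)
    (hbh : b ≤ h 1)
    (hG : ∀ s, s + min (h n) (2 * n - 2) + 2 ≤ 2 * n →
      ∑ k ∈ Finset.range (s + 2), w k • lastTerm x n (s + 1) (x k) ∈ absorb W c)
    (hx : x 1 * ∏ q ∈ Finset.Ioc 1 b, colFactor x n q (x 1) ∈ absorb W c)
    (hlift : ∀ p, 1 ≤ p → p ≤ b → ∀ v ∈ rootProducts (shiftVar x) (n - 1) (tailHess n h),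
      c * ((∏ q ∈ Finset.Ioc p b, colFactor x n q (x 1)) * v) ∈ W) :
    absorb W c = ⊤ := by
  set P : ℕ → A := fun p => ∏ q ∈ Finset.Ioc p b, colFactor x n q (x 1) with hP
  have hlast : ∀ p, ∀ y : ℕ → A ⧸ absorb W (c * P p), y = (fun k => Ideal.Quotient.mk _ (x k)) →
      ∀ s, s + min (h n) (2 * n - 2) + 2 ≤ 2 * n →
      ∑ k ∈ Finset.range (s + 2), w k • lastTerm y n (s + 1) (y k) = 0 := by
    intro p y hy s hs
    have h1 : ∑ k ∈ Finset.range (s + 2), w k • lastTerm x n (s + 1) (x k) ∈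
        absorb W (c * P p) := mem_absorb_mul.2 (Ideal.mul_mem_left _ _ (hG s hs))
    have h2 := Ideal.Quotient.eq_zero_iff_mem.2 h1
    rw [← Ideal.Quotient.mkₐ_eq_mk ℝ] at h2
    simp only [map_sum, map_smul, Ideal.Quotient.mkₐ_eq_mk, map_lastTerm] at h2
    rw [hy]; exact h2
  have hlift' : ∀ p, 1 ≤ p → p ≤ b →
      ∀ v ∈ rootProducts (shiftVar x) (n - 1) (tailHess n h), ∃ v' e,
      Ideal.Quotient.mk (absorb W (c * P p)) v =
        (-1) ^ e * Ideal.Quotient.mk (absorb W (c * P p)) v' ∧ c * P p * v' ∈ W :=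
    fun p hp hpb v hv => ⟨v, 0, by simp, by rw [mul_assoc]; exact hlift p hp hpb v hv⟩
  have key : ∀ p, 1 ≤ p → p ≤ b → absorb W (c * P p) = ⊤ := by
    intro p hp
    induction p, hp using Nat.le_induction with
    | base =>
      intro _
      have hmem : x 1 ∈ absorb W (c * P 1) := mem_absorb_mul.2 (by rw [mul_comm]; exact hx)
      have hz := Ideal.Quotient.eq_zero_iff_mem.2 hmem
      have h0 : ∀ B : Type v, ∀ [CommRing B], ∀ y : ℕ → B, shiftVar y 0 = 0 :=
        fun B _ y => by simp [shiftVar]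
      refine R.absorb_eq_top H hn ih (u := 0) (by omega) rfl (Or.inl (by rw [h0]; exact hz))
        (by intros; omega) (fun i _ _ _ => by rw [h0, hz]) (fun s hs => ?_)
        (hlift' 1 le_rfl (by omega))
      rw [sum_mergeWeight (by simp [R.zero])
        (fun t => lastTerm (fun k => Ideal.Quotient.mk (absorb W (c * P 1)) (x k)) n (s + 1) t)
        (by omega) (fun _ => by rw [h0, hz])]
      exact hlast 1 _ rfl s hs
    | succ p hp ihp =>
      intro hpb
      have hmem : colFactor x n (p + 1) (x 1) ∈ absorb W (c * P (p + 1)) := by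
        refine mem_absorb_of_absorb_mul_eq_top ?_
        have h0 := ihp (by omega)
        have hI : Finset.Ioc p b = insert (p + 1) (Finset.Ioc (p + 1) b) := by
          ext k; simp only [Finset.mem_insert, Finset.mem_Ioc]; omega
        simp only [hP] at h0 ⊢
        rwa [hI, Finset.prod_insert (by simp), mul_comm (colFactor _ _ _ _), ← mul_assoc] at h0
      have hz := Ideal.Quotient.eq_zero_iff_mem.2 hmem
      rw [map_colFactor] at hz
      have hx1 := hz
      rw [colFactor, if_pos (by omega), sub_eq_zero] at hx1
      have hsv : ∀ B : Type v, ∀ [CommRing B], ∀ y : ℕ → B, shiftVar y p = y (p + 1) :=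
        fun B _ y => by rw [shiftVar, if_neg (by omega)]
      refine R.absorb_eq_top H hn ih (u := p) (by omega) rfl (Or.inl (by rw [hsv]; exact hx1))
        (fun i hi hin hip => ?_) (fun i _ _ _ => by rw [hsv, hx1]) (fun s hs => ?_)
        (hlift' (p + 1) (by omega) hpb)
      · have := le_or_eq_max_of_step H.max H.step le_rfl (show 1 ≤ i by omega) hin
        exact rowTerm_eq_zero_of_colFactor (p := p + 1) (by omega) (by omega) hz
      · rw [sum_mergeWeight (by simp [R.zero])
          (fun t => lastTerm (fun k => Ideal.Quotient.mk (absorb W (c * P (p + 1))) (x k)) n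
            (s + 1) t)
          (fun hsp => lastTerm_eq_zero (p := p + 1) (by omega) (by omega) hx1)
          (fun _ => by rw [hsv, hx1])]
        exact hlast (p + 1) _ rfl s hs
  have h1 := key b hb le_rfl
  simpa [hP] using h1

theorem RootRelations.span_of_last_lt (R : RootRelations n h x w) (H : HessD n h) (hn : 2 ≤ n)
    (ih : SpanD.{v} (n - 1)) (hlast : h n + 1 < 2 * n) :
    Submodule.span ℝ (rootProducts x n h) = ⊤ := by
  have hh1 : h 1 ≤ n := by
    rcases hn.eq_or_lt with rfl | hn
    · have := H.max 1 le_rfl (by omega); omega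
    · by_contra h0
      have := H.last_ge 1 le_rfl (by omega) (by omega)
      omega
  have hh1' := H.le 1 le_rfl (by omega)
  have hle := H.le_last
  have hw := R.pos 1 le_rfl (by omega)
  have hF := R.row 1 le_rfl (by omega)
  have hG := R.last 1 (by omega)
  have hz := R.zero
  have hx : x 1 * ∏ q ∈ Finset.Ioc 1 (h 1), colFactor x n q (x 1) = 0 := by
    rw [← smul_eq_zero_iff_right hw.ne']
    rw [Finset.sum_range_succ, Finset.sum_range_one, hz] at hF hG
    have hcol : ∀ b ≤ n, ∀ t : A, ∏ q ∈ Finset.Ioc 1 b, colFactor x n q t =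
        ∏ q ∈ Finset.Ioc 1 b, (t - x q) := fun b hb t => Finset.prod_congr rfl fun q hq => by
      rw [colFactor, if_pos ((Finset.mem_Ioc.1 hq).2.trans hb)]
    have hsplit : ∀ t : A, lastTerm x n 1 t =
        (∏ q ∈ Finset.Ioc 1 (n - 1), (t - x q)) * (t - x n) := fun t => by
      rw [lastTerm, ← Finset.prod_Ioc_consecutive _ (show 1 ≤ n - 1 by omega)
        (show n - 1 ≤ n by omega)]
      have hI : Finset.Ioc (n - 1) n = {n} := by
        ext k; simp only [Finset.mem_Ioc, Finset.mem_singleton]; omega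
      rw [hI, Finset.prod_singleton]
    simp only [rowTerm, hcol _ hh1] at hF ⊢
    rcases lt_trichotomy (h 1) (n - 1) with h0 | h0 | h0
    · rw [if_pos (by omega), if_pos (by omega)] at hF
      simpa using hF
    · rw [if_neg (by omega), if_neg (by omega), h0] at hF
      rw [hsplit, hsplit] at hG
      rw [h0, ← smul_eq_zero_iff_right (two_ne_zero (α := ℝ))]
      rw [Algebra.smul_def, Algebra.smul_def] at hF hG ⊢
      rw [map_ofNat]
      linear_combination hF + hG
    · obtain h0 : h 1 = n := by omega
      rw [if_neg (by omega), if_neg (by omega), h0] at hF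
      rw [lastTerm, lastTerm] at hG
      rw [h0]
      rw [Algebra.smul_def, Algebra.smul_def] at hF hG
      rw [Algebra.smul_def]
      linear_combination hF - x n * hG
  refine eq_top_of_absorb_one_eq_top (R.absorb_eq_top_of_le H hn ih hh1' hh1 le_rfl
    (fun s hs => ?_) ?_ (fun p hp hpb v hv => ?_))
  · rw [R.last (s + 1) (by omega)]; exact zero_mem _
  · rw [hx]; exact zero_mem _
  · have h1 := mul_rootProd_mem_of_lt x H hn hp hpb hv
    rw [if_neg (by omega), mul_one] at h1
    rw [one_mul]
    exact Submodule.subset_span h1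

/-- Elimination of the first row when `x_1` and some `x_j` vanish. -/
theorem RowRelations.absorb_eq_top_of_mem (R : RowRelations n h x w) (H : HessD n h) (hn : 2 ≤ n)
    (hlast : h n + 1 = 2 * n) {p j : ℕ} (hp : n ≤ p) (hp1 : p ≤ h 1) (hj : 2 ≤ j) (hjn : j ≤ n)
    (hx1 : x 1 ∈ absorb (Submodule.span ℝ (rootProducts x n h))
      (∏ q ∈ Finset.Ioc p (h 1), colFactor x n q (x 1)))
    (hxj : x j ∈ absorb (Submodule.span ℝ (rootProducts x n h))
      (∏ q ∈ Finset.Ioc p (h 1), colFactor x n q (x 1))) :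
    absorb (Submodule.span ℝ (rootProducts x n h))
      (∏ q ∈ Finset.Ioc p (h 1), colFactor x n q (x 1)) = ⊤ := by
  set K := absorb (Submodule.span ℝ (rootProducts x n h))
      (∏ q ∈ Finset.Ioc p (h 1), colFactor x n q (x 1)) with hK
  set y : ℕ → A ⧸ K := fun k => Ideal.Quotient.mk K (x k) with hy
  have hy1 : y 1 = 0 := Ideal.Quotient.eq_zero_iff_mem.2 hx1
  have hyj : y j = 0 := Ideal.Quotient.eq_zero_iff_mem.2 hxj
  have hM : RowRelations n h y w := R.map_mk K
  have hlow : ∀ i, 2 ≤ i → i < n → n ≤ h i := fun i hi hin => by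
    have := le_or_eq_max_of_step H.max H.step le_rfl (show 1 ≤ i by omega) hin
    omega
  have hsum : ∀ (f : ℕ → A ⧸ K) (i : ℕ), 1 ≤ i →
      ∑ k ∈ Finset.range (i + 1), f k = f 0 + (f 1 + ∑ k ∈ Finset.Icc 2 i, f k) := by
    intro f i hi
    have hI : Finset.range (i + 1) = insert 0 (insert 1 (Finset.Icc 2 i)) := by
      ext k; simp only [Finset.mem_insert, Finset.mem_range, Finset.mem_Icc]; omega
    rw [hI, Finset.sum_insert (by simp), Finset.sum_insert (by simp)]
  have hsys : RowSystem n 2 h y (fun k => w k + if k = j then w 0 + w 1 else 0) j := by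
    refine ⟨hj, hjn, hyj, fun k hk hkn hkj => ?_, ?_, ?_, fun i hi hin => ?_⟩
    · simp only [hkj, if_false, add_zero]
      exact R.pos k (by omega) hkn
    · rw [Finset.sum_add_distrib, Finset.sum_ite_eq', if_pos (Finset.mem_Icc.2 ⟨hj, hjn⟩)]
      have h0 := R.sum
      have hI : Finset.range (n + 1) = insert 0 (insert 1 (Finset.Icc 2 n)) := by
        ext k; simp only [Finset.mem_insert, Finset.mem_range, Finset.mem_Icc]; omega
      rw [hI, Finset.sum_insert (by simp), Finset.sum_insert (by simp)] at h0
      linarith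
    · exact adjoin_eq_top_of_mem hj hjn (Or.inl (by rw [hy1, hyj])) hM.adjoin
    · have h0 := hM.row i (by omega) hin
      rw [hsum _ i (by omega), hM.zero, hy1] at h0
      simp only [add_smul, ite_smul, zero_smul]
      rw [Finset.sum_add_distrib, Finset.sum_ite_eq']
      by_cases hij : j ≤ i
      · rw [if_pos (Finset.mem_Icc.2 ⟨hj, hij⟩), hyj]
        refine Eq.trans ?_ h0
        abel
      · have h1 : rowTerm y n i (h i) 0 = 0 :=
          rowTerm_eq_zero_of_colFactor (p := j) (by omega) (by have := hlow i hi hin; omega)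
            (by rw [colFactor, if_pos hjn, hyj, sub_zero])
        rw [h1, smul_zero, smul_zero, zero_add, zero_add] at h0
        rw [if_neg (by simp [hij]), add_zero]
        exact h0
  refine absorb_eq_top_of_span_quotient _ (RowSystem.span_rowProducts (n - 2) (by omega) hlow
    (fun i hi => H.max i (by omega)) (fun i hi => H.step i (by omega)) hsys) ?_
  rintro _ ⟨L, hL, rfl⟩
  refine ⟨∏ i ∈ Finset.Ico 2 n, ∏ p ∈ Finset.Ioc (L i) (h i), colFactor x n p (x i),
    by simp only [map_prod, map_colFactor]; rfl, Submodule.subset_span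
      (mul_rowProducts_mem x hn hlast hp hp1 ⟨L, hL, rfl⟩)⟩

theorem RootRelations.span_of_last_eq (R : RootRelations n h x w) (H : HessD n h) (hn : 2 ≤ n)
    (ih : SpanD.{v} (n - 1)) (hlast : h n + 1 = 2 * n) :
    Submodule.span ℝ (rootProducts x n h) = ⊤ := by
  have hh1 : n ≤ h 1 + 1 := by
    rcases hn.eq_or_lt with rfl | hn
    · have := H.le 1 le_rfl (by omega); omega
    · exact H.ge_of_last 1 le_rfl (by omega) (by omega)
  have hh1' := H.max 1 le_rfl (by omega)
  have hw0 := R.weight_zero_ne (by omega)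
  have hw1 := (R.pos 1 le_rfl (by omega)).ne'
  have hz := R.zero
  set W := Submodule.span ℝ (rootProducts x n h) with hW
  set P : ℕ → A := fun p => ∏ q ∈ Finset.Ioc p (h 1), colFactor x n q (x 1) with hP
  set F : ℕ → A := fun p => w 0 • rowTerm x n 1 p 0 + w 1 • rowTerm x n 1 p (x 1) with hF
  have hPstep : ∀ p, p + 1 ≤ h 1 → P p = P (p + 1) * colFactor x n (p + 1) (x 1) := by
    intro p hp
    have hI : Finset.Ioc p (h 1) = insert (p + 1) (Finset.Ioc (p + 1) (h 1)) := by
      ext k; simp only [Finset.mem_insert, Finset.mem_Ioc]; omega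
    simp only [hP]
    rw [hI, Finset.prod_insert (by simp), mul_comm]
  have hrow_succ : ∀ p, n ≤ p + 1 → ∀ t, rowTerm x n 1 (p + 1) t =
      rowTerm x n 1 p t * colFactor x n (p + 1) t := by
    intro p hp t
    rw [rowTerm, rowTerm, if_neg (by omega), if_neg (by omega),
      Finset.prod_Ioc_succ_top (by omega)]
    ring
  have hx1N : x 1 * lastTerm x n 1 0 = 0 := by
    have h0 := R.last 0 (by omega)
    rw [zero_add, Finset.sum_range_one, hz, smul_eq_zero_iff_right hw0, lastTerm] at h0
    have hI : Finset.Ioc 0 n = insert 1 (Finset.Ioc 1 n) := by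
      ext k; simp only [Finset.mem_insert, Finset.mem_Ioc]; omega
    rw [hI, Finset.prod_insert (by simp)] at h0
    rw [lastTerm]
    linear_combination -h0
  have hrow_n : ∀ t, rowTerm x n 1 n t = (t + x n) * lastTerm x n 1 t := by
    intro t
    rw [rowTerm, if_neg (by omega), lastTerm]
    congr 1
    exact Finset.prod_congr rfl fun q hq => by rw [colFactor, if_pos (Finset.mem_Ioc.1 hq).2]
  have hN : rowTerm x n 1 (n - 1) 0 = -lastTerm x n 1 0 := by
    have hI : Finset.Ioc 1 n = insert n (Finset.Ioc 1 (n - 1)) := by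
      ext k; simp only [Finset.mem_insert, Finset.mem_Ioc]; omega
    rw [rowTerm, if_neg (by omega), lastTerm, hI,
      Finset.prod_insert (by simp only [Finset.mem_Ioc]; omega),
      Finset.prod_congr rfl (fun q hq => by
        rw [colFactor, if_pos ((Finset.mem_Ioc.1 hq).2.trans (by omega))])]
    ring
  have hx1row : ∀ p, n - 1 ≤ p → x 1 * rowTerm x n 1 p 0 = 0 := by
    intro p hp
    induction p, hp using Nat.le_induction with
    | base => rw [hN, mul_neg, hx1N, neg_zero]
    | succ p hp ihp => rw [hrow_succ p (by omega), ← mul_assoc, ihp, zero_mul]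
  have hFstep : ∀ p, n - 1 ≤ p → F p * colFactor x n (p + 1) (x 1) = F (p + 1) := by
    intro p hp
    have h0 := hx1row p hp
    have h1 : colFactor x n (p + 1) (x 1) = x 1 + colFactor x n (p + 1) 0 := by
      unfold colFactor; split_ifs <;> ring
    simp only [hF]
    rw [hrow_succ p (by omega), hrow_succ p (by omega)]
    simp only [Algebra.smul_def]
    linear_combination algebraMap ℝ A (w 0) * rowTerm x n 1 p 0 * h1 +
      algebraMap ℝ A (w 0) * h0
  have hPF : ∀ d p, p + d = h 1 → n - 1 ≤ p → P p * F p = 0 := by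
    intro d
    induction d with
    | zero =>
      intro p hp hnp
      have h0 := R.row 1 le_rfl (by omega)
      rw [Finset.sum_range_succ, Finset.sum_range_one, hz] at h0
      obtain rfl : p = h 1 := hp
      simp only [hF]
      rw [h0, mul_zero]
    | succ d ihd =>
      intro p hp hnp
      rw [hPstep p (by omega), mul_assoc, mul_comm (colFactor _ _ _ _), hFstep p hnp]
      exact ihd (p + 1) (by omega) (by omega)
  set b := min (h 1) n with hb
  have hbF : P b * F b = 0 := hPF (h 1 - b) b (by omega) (by omega)
  have hbFn : P b * F n = 0 := by
    rcases le_or_gt n (h 1) with h0 | h0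
    · have h1 : b = n := by omega
      rw [h1] at hbF ⊢
      exact hbF
    · have h1 : b + 1 = n := by omega
      rw [← h1, ← hFstep b (by omega), ← mul_assoc, hbF, zero_mul]
  have hadd : x 1 + x n ∈ absorb W (P b) := by
    refine mem_absorb_of_absorb_mul_eq_top (R.absorb_eq_top_of_le H hn ih (b := b) (by omega)
      (by omega) (by omega) (fun s hs => ?_) ?_ (fun p hp hpb v hv => ?_))
    · obtain rfl : s = 0 := by omega
      refine mem_absorb_of_mul_eq_zero ?_
      refine Eq.trans ?_ hbFn
      rw [zero_add, Finset.sum_range_succ, Finset.sum_range_one, hz]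
      simp only [hF, hrow_n, Algebra.smul_def]
      linear_combination P b * algebraMap ℝ A (w 0) * hx1N
    · refine mem_absorb_of_mul_eq_zero ((smul_eq_zero_iff_right hw1).1 ?_)
      have h0 : rowTerm x n 1 b (x 1) = (x 1 + x n) *
          ∏ q ∈ Finset.Ioc 1 b, colFactor x n q (x 1) := by rw [rowTerm, if_neg (by omega)]
      have h1 := hx1row b (by omega)
      simp only [hF, Algebra.smul_def] at hbF ⊢
      linear_combination x 1 * hbF - P b * algebraMap ℝ A (w 0) * h1 -
        P b * algebraMap ℝ A (w 1) * x 1 * h0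
    · have h1 := mul_rootProd_mem_of_lt x H hn hp (by omega) hv
      rw [if_pos hlast, if_neg (by omega),
        ← Finset.prod_Ioc_consecutive _ hpb (show b ≤ h 1 by omega)] at h1
      refine Submodule.subset_span ?_
      convert h1 using 1
      ring
  have htop_pred : absorb W (P (n - 1)) = ⊤ := by
    have hadd' : x 1 + x n ∈ absorb W (P (n - 1)) := by
      have h0 : P (n - 1) = P b * ∏ q ∈ Finset.Ioc (n - 1) b, colFactor x n q (x 1) := by
        simp only [hP]
        rw [mul_comm, Finset.prod_Ioc_consecutive _ (by omega) (by omega)]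
      rw [h0]
      exact mem_absorb_mul.2 (Ideal.mul_mem_left _ _ hadd)
    have hN' : lastTerm x n 1 0 ∈ absorb W (P (n - 1)) := by
      have h1 : F (n - 1) ∈ absorb W (P (n - 1)) :=
        mem_absorb_of_mul_eq_zero (hPF (h 1 - (n - 1)) (n - 1) (by omega) le_rfl)
      have h2 : rowTerm x n 1 (n - 1) (x 1) ∈ absorb W (P (n - 1)) := by
        rw [rowTerm, if_neg (by omega)]
        exact Ideal.mul_mem_right _ _ hadd'
      have h3 : w 0 • rowTerm x n 1 (n - 1) 0 ∈ absorb W (P (n - 1)) := by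
        have h4 := sub_mem h1 (Submodule.smul_of_tower_mem _ (w 1) h2)
        simpa [hF] using h4
      have h5 := Submodule.smul_of_tower_mem _ (w 0)⁻¹ h3
      rw [inv_smul_smul₀ hw0, hN] at h5
      exact neg_mem_iff.1 h5
    have hyadd : Ideal.Quotient.mk (absorb W (P (n - 1))) (x 1) +
        Ideal.Quotient.mk (absorb W (P (n - 1))) (x n) = 0 := by
      rw [← map_add]; exact Ideal.Quotient.eq_zero_iff_mem.2 hadd'
    refine R.absorb_eq_top H hn ih (u := n - 1) (by omega) rfl (Or.inr ?_)
      (fun i hi hin _ => ?_) (by intros; omega) (fun s hs => ?_) (fun v hv => ?_)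
    · rw [shiftVar, if_neg (by omega), Nat.sub_add_cancel (by omega)]
      exact eq_neg_of_add_eq_zero_left hyadd
    · have := le_or_eq_max_of_step H.max H.step le_rfl (show 1 ≤ i by omega) hin
      exact rowTerm_eq_zero_of_add (by omega) hyadd
    · obtain rfl : s = 0 := by omega
      have h0 := Ideal.Quotient.eq_zero_iff_mem.2 hN'
      rw [map_lastTerm, map_zero] at h0
      rw [zero_add, Finset.sum_range_one, shiftVar, if_pos rfl, h0, smul_zero]
    · obtain ⟨v', e, he, hv'⟩ := exists_mul_mem_rootProducts x H hn hh1 hlast _ hyadd hv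
      exact ⟨v', e, he, Submodule.subset_span hv'⟩
  have key : ∀ p, n ≤ p → p ≤ h 1 → absorb W (P p) = ⊤ := by
    intro p hp
    induction p, hp using Nat.le_induction with
    | base =>
      intro hnh
      have hb' : b = n := by omega
      rw [hb'] at hadd
      have hsub : x 1 - x n ∈ absorb W (P n) := by
        refine mem_absorb_of_absorb_mul_eq_top ?_
        have h0 := hPstep (n - 1) (by omega)
        rw [Nat.sub_add_cancel (by omega), colFactor, if_pos le_rfl] at h0
        rw [← h0]
        exact htop_pred
      have htwo : ∀ a : A, a + a ∈ absorb W (P n) → a ∈ absorb W (P n) := by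
        intro a ha
        have h1 := Submodule.smul_of_tower_mem _ (2⁻¹ : ℝ) ha
        rwa [← two_smul ℝ a, inv_smul_smul₀ two_ne_zero] at h1
      refine R.absorb_eq_top_of_mem H hn hlast le_rfl hnh hn le_rfl (htwo _ ?_) (htwo _ ?_)
      · have h1 := add_mem hadd hsub
        rwa [add_add_sub_cancel] at h1
      · have h1 := sub_mem hadd hsub
        rwa [add_sub_sub_cancel] at h1
    | succ p hp ihp =>
      intro hp1
      obtain ⟨j, hj⟩ : ∃ j, j + (p + 1) = 2 * n := ⟨2 * n - (p + 1), by omega⟩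
      have hcol : colFactor x n (p + 1) (x 1) = x 1 + x j := by
        rw [colFactor, if_neg (by omega), ← hj, Nat.add_sub_cancel]
      have hmem : x 1 + x j ∈ absorb W (P (p + 1)) := by
        refine mem_absorb_of_absorb_mul_eq_top ?_
        rw [← hcol, ← hPstep p hp1]
        exact ihp (by omega)
      have hx1 : x 1 ∈ absorb W (P (p + 1)) := by
        refine mem_absorb_of_absorb_mul_eq_top ?_
        have hmem' : colFactor x n (p + 1) (x 1) ∈ absorb W (P (p + 1) * x 1) := by
          rw [hcol]
          exact mem_absorb_mul.2 (Ideal.mul_mem_left _ _ hmem)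
        have hN' : lastTerm x n 1 0 ∈ absorb W (P (p + 1) * x 1) :=
          mem_absorb_of_mul_eq_zero (by rw [mul_assoc, hx1N, mul_zero])
        have hz1 := Ideal.Quotient.eq_zero_iff_mem.2 hmem'
        have hyadd := hz1
        rw [hcol, map_add] at hyadd
        rw [map_colFactor] at hz1
        have hsv : ∀ B : Type v, ∀ [CommRing B], ∀ y : ℕ → B, shiftVar y (j - 1) = y j :=
          fun B _ y => by rw [shiftVar, if_neg (by omega), Nat.sub_add_cancel (by omega)]
        refine R.absorb_eq_top H hn ih (u := j - 1) (by omega) rfl (Or.inr ?_)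
          (fun i hi hin hij => ?_) (fun i hi hin hij => ?_) (fun s hs => ?_) (fun v hv => ?_)
        · rw [hsv]; exact eq_neg_of_add_eq_zero_left hyadd
        · have := le_or_eq_max_of_step H.max H.step le_rfl (show 1 ≤ i by omega) hin
          exact rowTerm_eq_zero_of_colFactor (p := p + 1) (by omega) (by omega) hz1
        · have := le_or_eq_max_of_step H.max H.step le_rfl (show 1 ≤ i by omega) hin
          have := H.max i (by omega) hin
          rw [hsv, eq_neg_of_add_eq_zero_left hyadd]
          exact rowTerm_neg hin (by omega)
        · obtain rfl : s = 0 := by omega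
          have h0 := Ideal.Quotient.eq_zero_iff_mem.2 hN'
          rw [map_lastTerm, map_zero] at h0
          rw [zero_add, Finset.sum_range_one, shiftVar, if_pos rfl, h0, smul_zero]
        · refine ⟨v, 0, by simp, Submodule.subset_span ?_⟩
          have h1 := mul_rootProd_mem_of_lt x H hn (show 1 ≤ p + 1 by omega) hp1 hv
          rw [if_pos hlast, if_pos (by omega)] at h1
          convert h1 using 1
          ring
      refine R.absorb_eq_top_of_mem H hn hlast (by omega) hp1 (show 2 ≤ j by omega) (by omega)
        hx1 ?_
      have h1 := sub_mem hmem hx1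
      rwa [add_sub_cancel_left] at h1
  refine eq_top_of_absorb_one_eq_top ?_
  have hend : P (h 1) = 1 := by simp [hP]
  rw [← hend]
  rcases le_or_gt n (h 1) with h0 | h0
  · exact key (h 1) h0 le_rfl
  · rw [show h 1 = n - 1 by omega]; exact htop_pred

theorem spanD_of_one_le (hn : 1 ≤ n) : SpanD.{v} n := by
  induction n, hn using Nat.le_induction with
  | base =>
    intro h H A _ _ x w R
    have hlast := H.last_le
    have h0 := R.last 0 (by omega)
    rw [zero_add, Finset.sum_range_one, smul_eq_zero_iff_right (R.weight_zero_ne le_rfl),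
      lastTerm, Nat.Ioc_succ_singleton, Finset.prod_singleton, R.zero, zero_sub, neg_eq_zero] at h0
    refine span_eq_top_of_adjoin_zero ?_ R.adjoin
      ⟨id, fun i hi hin => ⟨le_rfl, ?_⟩, ?_⟩
    · rintro _ ⟨k, ⟨hk, hk'⟩, rfl⟩
      rw [le_antisymm hk' hk]; exact h0
    · rw [le_antisymm hin hi]; exact H.le_last
    · rw [rootProd, Finset.Icc_self, Finset.prod_singleton,
        Finset.Ioc_eq_empty_of_le (by simp; omega), Finset.prod_empty]
  | succ n hn ihn =>
    intro h H A _ _ x w R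
    rcases (H.last_le).lt_or_eq with h0 | h0
    · exact R.span_of_last_lt H (by omega) ihn h0
    · exact R.span_of_last_eq H (by omega) ihn h0

end SpanD

theorem prod_Ioc_eq_mul_prod_Ioc_succ {A : Type*} [CommRing A] {i j : ℕ} (hij : i < j)
    (f : ℕ → A) :
    ∏ p ∈ Finset.Ioc i j, f p = f (i + 1) * ∏ p ∈ Finset.Ioc (i + 1) j, f p := by
  have hI : Finset.Ioc i j = insert (i + 1) (Finset.Ioc (i + 1) j) := by
    ext k; simp only [Finset.mem_insert, Finset.mem_Ioc]; omega
  rw [hI, Finset.prod_insert (by simp)]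

section Closure

variable {A : Type*} [CommRing A] [Algebra ℝ A] {n : ℕ} {h : ℕ → ℕ} {x : ℕ → A} {w : ℕ → ℝ}

/-- The weighted sum of the values `φ(x_k) (x_k - x_{i+1}) ⋯ (x_k - x_j)` over `k ≤ i`. -/
def weightedSum (x : ℕ → A) (w : ℕ → ℝ) (φ : A → A) (i j : ℕ) : A :=
  ∑ k ∈ Finset.range (i + 1), w k • (φ (x k) * ∏ p ∈ Finset.Ioc i j, (x k - x p))

theorem weightedSum_eq_sub_mul (x : ℕ → A) (w : ℕ → ℝ) (φ : A → A) {i j : ℕ} (hij : i < j) :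
    weightedSum x w φ i j = weightedSum x w (fun t => (t - x (i + 1)) * φ t) (i + 1) j := by
  unfold weightedSum
  beta_reduce
  rw [Finset.sum_range_succ _ (i + 1), sub_self, zero_mul, zero_mul, smul_zero, add_zero]
  refine Finset.sum_congr rfl fun k _ => ?_
  rw [prod_Ioc_eq_mul_prod_Ioc_succ hij]
  congr 1
  ring

theorem weightedSum_succ_right (x : ℕ → A) (w : ℕ → ℝ) (φ : A → A) {i j : ℕ} (hij : i ≤ j) :
    weightedSum x w φ i (j + 1) = weightedSum x w (fun t => (t - x (j + 1)) * φ t) i j := by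
  unfold weightedSum
  refine Finset.sum_congr rfl fun k _ => ?_
  rw [Finset.prod_Ioc_succ_top hij]
  congr 1
  ring

theorem weightedSum_linear (x : ℕ → A) (w : ℕ → ℝ) {φ ψ χ : A → A} (a b : A)
    (hφ : ∀ t, φ t = a * ψ t + b * χ t) (i j : ℕ) :
    weightedSum x w φ i j = a * weightedSum x w ψ i j + b * weightedSum x w χ i j := by
  unfold weightedSum
  rw [Finset.mul_sum, Finset.mul_sum, ← Finset.sum_add_distrib]
  refine Finset.sum_congr rfl fun k _ => ?_
  rw [hφ, mul_smul_comm, mul_smul_comm, ← smul_add]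
  congr 1
  ring

theorem weightedSum_succ_succ (x : ℕ → A) (w : ℕ → ℝ) (φ : A → A) {i j : ℕ} (hij : i < j) :
    weightedSum x w φ (i + 1) (j + 1) =
      weightedSum x w φ i j + (x (i + 1) - x (j + 1)) * weightedSum x w φ (i + 1) j := by
  rw [weightedSum_succ_right x w φ (show i + 1 ≤ j from hij), weightedSum_eq_sub_mul x w φ hij,
    weightedSum_linear x w 1 (x (i + 1) - x (j + 1)) (χ := φ) (fun t => ?_), one_mul]
  ring

theorem sum_lastTerm_eq_weightedSum (r : ℕ) :
    ∑ k ∈ Finset.range (r + 1), w k • lastTerm x n r (x k) =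
      weightedSum x w (fun _ => 1) r n := by
  simp [weightedSum, lastTerm]

theorem sum_rowTerm_eq_weightedSum {i j : ℕ} (hj : j ≤ n) :
    ∑ k ∈ Finset.range (i + 1), w k • rowTerm x n i j (x k) =
      weightedSum x w (fun t => if j ≤ n - 2 then t else t + x n) i j := by
  refine Finset.sum_congr rfl fun k _ => ?_
  rw [rowTerm]
  congr 2
  exact Finset.prod_congr rfl fun q hq => by
    rw [colFactor, if_pos ((Finset.mem_Ioc.1 hq).2.trans hj)]

theorem RowRelations.weightedSum_id_eq_zero (R : RowRelations n h x w) (H : HessD n h) {i j : ℕ}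
    (hin : i < n) (hi : 1 ≤ i → h i ≤ n - 2 ∧ h i ≤ j) (hj : j < n) :
    weightedSum x w id i j = 0 := by
  induction i generalizing j with
  | zero => simp [weightedSum, R.zero]
  | succ i ihi =>
    obtain ⟨hi1, hij⟩ := hi (by omega)
    have hle := H.le (i + 1) (by omega) hin
    induction j, hij using Nat.le_induction with
    | base =>
      have h0 := R.row (i + 1) (by omega) hin
      rw [sum_rowTerm_eq_weightedSum (by omega)] at h0
      simp only [hi1, if_true] at h0
      exact h0
    | succ j hj' ihj =>
      rw [weightedSum_succ_succ _ _ _ (by omega), ihj (fun _ => ⟨hi1, hj'⟩) (by omega), mul_zero,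
        add_zero]
      refine ihi (by omega) (fun h1 => ?_) (by omega)
      have := H.step i h1 (by omega)
      omega

theorem RowRelations.weightedSum_one_pred (R : RowRelations n h x w) (H : HessD n h) {s : ℕ}
    (hs : s + 1 + h n + 1 ≤ 2 * n) (h0 : weightedSum x w (fun _ => 1) (s + 1) n = 0) :
    weightedSum x w (fun _ => 1) s n = 0 := by
  have hlast := H.le_last
  obtain ⟨m, rfl⟩ : ∃ m, n = m + 1 := ⟨n - 1, by omega⟩
  have hle := H.le (s + 1) (by omega) (by omega)
  have hmax := H.max (s + 1) (by omega) (by omega)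
  have hge := H.last_ge (s + 1) (by omega)
  have hstep := H.step s
  have hrow := R.row (s + 1) (by omega) (by omega)
  rw [sum_rowTerm_eq_weightedSum (by omega)] at hrow
  set φ : A → A := fun t => t + x (m + 1) with hφ
  have hG : weightedSum x w (fun _ => 1) s (m + 1) = weightedSum x w φ (s + 1) (m + 1) := by
    rw [weightedSum_eq_sub_mul x w _ (by omega),
      weightedSum_linear x w 1 (-(x (s + 1) + x (m + 1))) (ψ := φ) (χ := fun _ => 1)
        (fun t => by simp only [hφ]; ring), h0]
    ring
  have htwo : ∀ i, i ≤ m → weightedSum x w φ i m =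
      2 * weightedSum x w id i m + -1 * weightedSum x w (fun _ => 1) i (m + 1) := by
    intro i hi
    rw [weightedSum_succ_right x w _ hi]
    exact weightedSum_linear x w _ _ (fun t => by simp only [hφ, id]; ring) _ _
  rcases eq_or_ne (h (s + 1)) (m + 1) with h1 | h1
  · rw [hG, ← hrow, h1]
    simp only [show ¬ m + 1 ≤ m + 1 - 2 by omega, if_false, hφ]
  have hsm : weightedSum x w φ (s + 1) m = 0 := by
    rcases eq_or_ne (h (s + 1)) m with h2 | h2
    · rw [← hrow, h2]
      simp only [show ¬ m ≤ m + 1 - 2 by omega, if_false, hφ]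
    · rw [htwo _ (by omega), h0, R.weightedSum_id_eq_zero H (by omega)
        (fun _ => ⟨by omega, by omega⟩) (by omega)]
      simp
  rw [weightedSum_succ_succ x w φ (by omega), hsm, mul_zero, add_zero] at hG
  by_cases h3 : 1 ≤ s ∧ h s = m
  · have h4 := R.row s h3.1 (by omega)
    rw [sum_rowTerm_eq_weightedSum (by omega), h3.2] at h4
    rw [hG, ← h4]
    simp only [show ¬ m ≤ m + 1 - 2 by omega, if_false, hφ]
  · rw [htwo s (by omega), R.weightedSum_id_eq_zero H (by omega)
      (fun h5 => ⟨by have := hstep h5; omega, by have := hstep h5; omega⟩) (by omega)] at hG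
    have h6 : (2 : ℝ) • weightedSum x w (fun _ => 1) s (m + 1) = 0 := by
      rw [two_smul]; linear_combination hG
    exact (smul_eq_zero_iff_right two_ne_zero).1 h6

/-- A single relation for the last row implies all the smaller ones. -/
theorem RowRelations.toRootRelations (R : RowRelations n h x w) (H : HessD n h)
    (h0 : ∑ k ∈ Finset.range (2 * n - 1 - h n + 1),
      w k • lastTerm x n (2 * n - 1 - h n) (x k) = 0) : RootRelations n h x w := by
  refine ⟨R, fun r hr => ?_⟩
  rw [sum_lastTerm_eq_weightedSum] at h0 ⊢
  have hr' : r ≤ 2 * n - 1 - h n := by omega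
  induction hr' using Nat.decreasingInduction with
  | self => exact h0
  | of_succ r hr ih => exact R.weightedSum_one_pred H (by omega) (ih (by omega))

end Closure

/-- The weight `-n` of the value `0` and `1` of the variables. -/
def dWeight (n : ℕ) : ℕ → ℝ := fun k => if k = 0 then -(n : ℝ) else 1

theorem xv_zero (n : ℕ) : xv n 0 = 0 := by simp [xv]

theorem sum_range_succ_dWeight_smul {M : Type*} [AddCommGroup M] [Module ℝ M] (n i : ℕ)
    (g : ℕ → M) :
    ∑ k ∈ Finset.range (i + 1), dWeight n k • g k =
      ∑ k ∈ Finset.Icc 1 i, g k - (n : ℝ) • g 0 := by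
  have hI : Finset.range (i + 1) = insert 0 (Finset.Icc 1 i) := by
    ext k; simp only [Finset.mem_insert, Finset.mem_Icc, Finset.mem_range]; omega
  rw [hI, Finset.sum_insert (by simp), dWeight, if_pos rfl, neg_smul, neg_add_eq_sub]
  congr 1
  exact Finset.sum_congr rfl fun k hk => by
    rw [dWeight, if_neg (Nat.one_le_iff_ne_zero.1 (Finset.mem_Icc.1 hk).1), one_smul]

theorem prod_Ioc_zero_sub {A : Type*} [CommRing A] (x : ℕ → A) (i j : ℕ) :
    ∏ p ∈ Finset.Ioc i j, (0 - x p) = (-1) ^ (j - i) * ∏ p ∈ Finset.Ioc i j, x p := by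
  simp only [zero_sub]
  rw [Finset.prod_neg, Nat.card_Ioc]

theorem fDij_row {n i j : ℕ} (hin : i < n) (hj : j + i + 1 ≤ 2 * n) :
    fDij n i j =
      ∑ k ∈ Finset.range (i + 1), dWeight n k • rowTerm (xv n) n i j (xv n k) := by
  rw [sum_range_succ_dWeight_smul, xv_zero, fDij, if_neg hin.ne]
  split_ifs with h1 h2
  · rw [show rowTerm (xv n) n i j 0 = 0 by rw [rowTerm, if_pos h1, zero_mul], smul_zero, sub_zero]
    refine Finset.sum_congr rfl fun k _ => ?_
    rw [rowTerm, if_pos h1, mul_comm, Finset.Icc_add_one_left_eq_Ioc]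
    congr 1
    exact Finset.prod_congr rfl fun p hp => by
      rw [colFactor, if_pos (by have := (Finset.mem_Ioc.1 hp).2; omega)]
  · have hrow : ∀ t, rowTerm (xv n) n i j t =
        (∏ p ∈ Finset.Ioc i (n - 1), (t - xv n p)) * (t + xv n n) := by
      intro t
      rw [rowTerm, if_neg h1, mul_comm, ← h2]
      congr 1
      exact Finset.prod_congr rfl fun p hp => by
        rw [colFactor, if_pos (by have := (Finset.mem_Ioc.1 hp).2; omega)]
    obtain ⟨m, rfl⟩ : ∃ m, n = m + 1 := ⟨n - 1, by omega⟩
    simp only [hrow, Finset.Icc_add_one_left_eq_Ioc, Nat.add_sub_cancel, prod_Ioc_zero_sub,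
      zero_add]
    rw [sub_eq_add_neg, Finset.prod_Ioc_succ_top (by omega), Nat.succ_sub (by omega), pow_succ]
    simp only [Algebra.smul_def, map_mul, map_pow, map_neg, map_one]
    ring
  · have hI : 2 * n - j = n - (j - n) := by omega
    have hJ : Finset.Icc (n - (j - n)) n = Finset.Ioc (n - 1 - (j - n)) n := by
      ext k; simp only [Finset.mem_Ioc, Finset.mem_Icc]; omega
    simp only [rowTerm_eq_prod_mul_prod hin (show n ≤ j by omega) (show j < 2 * n by omega),
      Finset.Icc_add_one_left_eq_Ioc, prod_Ioc_zero_sub, zero_add, hI, hJ]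
    rw [sub_eq_add_neg, Finset.prod_pow,
      ← Finset.prod_Ioc_consecutive (xv n) (show i ≤ n - 1 - (j - n) by omega)
        (show n - 1 - (j - n) ≤ n by omega),
      pow_succ]
    simp only [Algebra.smul_def, map_mul, map_pow, map_neg, map_one]
    ring

theorem fDij_last (n j : ℕ) :
    fDij n n j = (-1 : ℝ) ^ (n - (2 * n - 1 - j) + 1) •
      ∑ k ∈ Finset.range (2 * n - 1 - j + 1),
        dWeight n k • lastTerm (xv n) n (2 * n - 1 - j) (xv n k) := by
  rw [sum_range_succ_dWeight_smul, xv_zero, fDij, if_pos rfl, smul_sub, Finset.smul_sum,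
    sub_eq_add_neg]
  simp only [lastTerm, Finset.Icc_add_one_left_eq_Ioc, prod_Ioc_zero_sub]
  congr 1
  have h0 : ((-1 : MvPolynomial (Fin n) ℝ) ^ (n - (2 * n - 1 - j))) ^ 2 = 1 := by
    rw [← pow_mul, mul_comm, pow_mul, neg_one_sq, one_pow]
  simp only [Algebra.smul_def, map_pow, map_neg, map_one]
  linear_combination (-(algebraMap ℝ (MvPolynomial (Fin n) ℝ) n *
    ∏ p ∈ Finset.Ioc (2 * n - 1 - j) n, xv n p)) * h0

section Homogeneous

variable {n : ℕ}

theorem isHomogeneous_xv (k : ℕ) : (xv n k).IsHomogeneous 1 := by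
  unfold xv
  split_ifs
  · exact isHomogeneous_X _ _
  · exact isHomogeneous_zero _ _ _

theorem isHomogeneous_alDMod (ℓ : ℕ → ℤ) (i j : ℕ) : (alDMod (xv n) n ℓ i j).IsHomogeneous 1 := by
  unfold alDMod alD
  split_ifs <;>
    first
    | exact isHomogeneous_xv _
    | exact (isHomogeneous_xv _).add (isHomogeneous_xv _)
    | exact (isHomogeneous_xv _).sub (isHomogeneous_xv _)

theorem isHomogeneous_prod_card {ι : Type*} (s : Finset ι) (φ : ι → MvPolynomial (Fin n) ℝ)
    (hφ : ∀ i ∈ s, (φ i).IsHomogeneous 1) : (∏ i ∈ s, φ i).IsHomogeneous s.card := by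
  simpa using IsHomogeneous.prod s φ (fun _ => 1) hφ

theorem isHomogeneous_rowTerm (i j k : ℕ) :
    (rowTerm (xv n) n i j (xv n k)).IsHomogeneous (j - i + 1) := by
  rw [rowTerm, add_comm (j - i), ← Nat.card_Ioc i j]
  refine IsHomogeneous.mul ?_ (isHomogeneous_prod_card _ _ fun p _ => ?_)
  · split_ifs
    · exact isHomogeneous_xv _
    · exact (isHomogeneous_xv _).add (isHomogeneous_xv _)
  · unfold colFactor
    split_ifs
    · exact (isHomogeneous_xv _).sub (isHomogeneous_xv _)
    · exact (isHomogeneous_xv _).add (isHomogeneous_xv _)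

theorem isHomogeneous_lastTerm (r k : ℕ) :
    (lastTerm (xv n) n r (xv n k)).IsHomogeneous (n - r) := by
  rw [lastTerm, ← Nat.card_Ioc]
  exact isHomogeneous_prod_card _ _ fun p _ => (isHomogeneous_xv _).sub (isHomogeneous_xv _)

theorem isHomogeneous_sum_smul {ι : Type*} (s : Finset ι) (w : ι → ℝ)
    (φ : ι → MvPolynomial (Fin n) ℝ) {d : ℕ} (hφ : ∀ i ∈ s, (φ i).IsHomogeneous d) :
    (∑ i ∈ s, w i • φ i).IsHomogeneous d :=
  IsHomogeneous.sum _ _ _ fun i hi => (homogeneousSubmodule (Fin n) ℝ d).smul_mem _ (hφ i hi)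

theorem HessD.isHomogeneous_fDij {h : ℕ → ℕ} (H : HessD n h) {i : ℕ} (hi : 1 ≤ i) (hin : i ≤ n) :
    (fDij n i (h i)).IsHomogeneous (h i - i + 1) := by
  rcases hin.lt_or_eq with hlt | rfl
  · rw [fDij_row hlt (H.max i hi hlt)]
    exact isHomogeneous_sum_smul _ _ _ fun k _ => isHomogeneous_rowTerm _ _ _
  · have h1 := H.le_last
    have h2 := H.last_le
    rw [fDij_last, show h i - i + 1 = i - (2 * i - 1 - h i) by omega]
    exact (homogeneousSubmodule (Fin i) ℝ _).smul_mem _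
      (isHomogeneous_sum_smul _ _ _ fun k _ => isHomogeneous_lastTerm _ _)

end Homogeneous

section Assembly

variable {n : ℕ} {h : ℕ → ℕ}

theorem mk_fDij_eq_zero {i : ℕ} (hi : 1 ≤ i) (hin : i ≤ n) :
    Ideal.Quotient.mk (IDh n h) (fDij n i (h i)) = 0 :=
  Ideal.Quotient.eq_zero_iff_mem.2 (Ideal.subset_span ⟨i, ⟨hi, hin⟩, rfl⟩)

theorem HessD.rootRelations (H : HessD n h) :
    RootRelations n h (fun k => Ideal.Quotient.mk (IDh n h) (xv n k)) (dWeight n) := by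
  have hn : 1 ≤ n := by have := H.le_last; have := H.last_le; omega
  refine RowRelations.toRootRelations ⟨by simp [xv_zero], ?_, ?_, ?_, ?_⟩ H ?_
  · refine adjoin_image_quotient_eq_top ?_ _
    rw [← top_le_iff, ← adjoin_range_X]
    refine Algebra.adjoin_mono ?_
    rintro _ ⟨k, rfl⟩
    exact ⟨k + 1, ⟨by omega, by omega⟩, by
      rw [xv, dif_pos ⟨by omega, by omega⟩]; simp⟩
  · intro k hk _
    rw [dWeight, if_neg (by omega)]
    exact one_pos
  · have := sum_range_succ_dWeight_smul n n (fun _ => (1 : ℝ))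
    simpa using this
  · intro i hi hin
    have h0 := mk_fDij_eq_zero (h := h) hi hin.le
    rw [fDij_row hin (H.max i hi hin)] at h0
    rw [← Ideal.Quotient.mkₐ_eq_mk ℝ] at h0
    simpa only [map_sum, map_smul, Ideal.Quotient.mkₐ_eq_mk, map_rowTerm] using h0
  · have h0 := mk_fDij_eq_zero (h := h) hn le_rfl
    rw [fDij_last, ← Ideal.Quotient.mkₐ_eq_mk ℝ, map_smul,
      smul_eq_zero_iff_right (pow_ne_zero _ (neg_ne_zero.2 one_ne_zero))] at h0
    simpa only [map_sum, map_smul, Ideal.Quotient.mkₐ_eq_mk, map_lastTerm] using h0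

theorem prod_range_sub_eq_prod_Ioc {M : Type*} [CommMonoid M] (f : ℕ → M) {a m : ℕ} (hm : m ≤ a) :
    ∏ t ∈ Finset.range m, f (a - t) = ∏ p ∈ Finset.Ioc (a - m) a, f p := by
  refine Finset.prod_bij' (fun t _ => a - t) (fun p _ => a - p) ?_ ?_ ?_ ?_ ?_ <;>
    intro p hp <;> simp only [Finset.mem_Ioc, Finset.mem_range] at hp ⊢ <;> omega

theorem prod_Icc_one_eq_prod_fin {M : Type*} [CommMonoid M] (f : ℕ → M) (n : ℕ) :
    ∏ i ∈ Finset.Icc 1 n, f i = ∏ i : Fin n, f (i.val + 1) := by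
  rw [← Finset.prod_range (fun i => f (i + 1)), Finset.range_eq_Ico, Finset.prod_Ico_add' f 0 n 1]
  rfl

theorem HessD.rootProducts_subset (H : HessD n h) :
    rootProducts (fun k => Ideal.Quotient.mk (IDh n h) (xv n k)) n h ⊆ Set.range (vDh n h) := by
  rintro _ ⟨L, hL, rfl⟩
  have hL' : ∀ i : Fin n, i.val + 1 ≤ L (i.val + 1) ∧ L (i.val + 1) ≤ h (i.val + 1) :=
    fun i => hL _ (by omega) (by omega)
  refine ⟨fun i => ⟨h (i.val + 1) - L (i.val + 1), by have := hL' i; omega⟩, ?_⟩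
  rw [vDh, ← map_rootProd, rootProd, prod_Icc_one_eq_prod_fin]
  congr 1
  refine Finset.prod_congr rfl fun i _ => ?_
  have h0 := hL' i
  have h1 := H.last_le
  rw [prod_range_sub_eq_prod_Ioc _ (by simp), Nat.sub_sub_self h0.2]
  refine Finset.prod_congr rfl fun p hp => ?_
  rw [Finset.mem_Ioc] at hp
  refine alDMod_congr _ (by omega) (by omega) (by omega) (fun h2 => ?_) fun r hr hrn => ?_
  · rw [h2] at hp; omega
  · have h3 := hL r hr hrn
    simp only [ellOf, hr, hrn, and_self, dif_pos, Nat.sub_add_cancel hr]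
    omega

theorem HessD.span_vDh (H : HessD n h) : Submodule.span ℝ (Set.range (vDh n h)) = ⊤ := by
  have hn : 1 ≤ n := by have := H.le_last; have := H.last_le; omega
  rw [← top_le_iff, ← spanD_of_one_le hn h H _ _ _ H.rootRelations]
  exact Submodule.span_mono H.rootProducts_subset

theorem IDh_eq_span_range (n : ℕ) (h : ℕ → ℕ) :
    IDh n h = Ideal.span (Set.range fun i : Fin n => fDij n (i.val + 1) (h (i.val + 1))) := by
  refine congrArg Ideal.span (Set.Subset.antisymm ?_ ?_)
  · rintro _ ⟨i, ⟨hi, hin⟩, rfl⟩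
    exact ⟨⟨i - 1, by omega⟩, by simp only [Nat.sub_add_cancel hi]⟩
  · rintro _ ⟨i, rfl⟩
    exact ⟨i + 1, ⟨by omega, by omega⟩, rfl⟩

theorem HessD.linearIndependent_vDh (H : HessD n h) : LinearIndependent ℝ (vDh n h) := by
  have key : ∀ I : Ideal (MvPolynomial (Fin n) ℝ),
      I = Ideal.span (Set.range fun i : Fin n => fDij n (i.val + 1) (h (i.val + 1))) →
      ∀ b : ((i : Fin n) → Fin (h (i.val + 1) - (i.val + 1) + 1)) → MvPolynomial (Fin n) ℝ,
      (∀ m, (b m).IsHomogeneous (∑ i : Fin n, (m i : ℕ))) →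
      Submodule.span ℝ (Set.range fun m => Ideal.Quotient.mk I (b m)) = ⊤ →
      LinearIndependent ℝ fun m => Ideal.Quotient.mk I (b m) := by
    rintro _ rfl b hb hspan
    exact linearIndependent_of_card_eq_prod_degrees (fun i => Nat.succ_pos _)
      (fun i => H.isHomogeneous_fDij (by omega) (by omega)) hb hspan (by simp)
  refine key _ (IDh_eq_span_range n h) _ (fun m => ?_) H.span_vDh
  refine IsHomogeneous.prod _ _ _ fun i _ => ?_
  have h0 := isHomogeneous_prod_card (Finset.range (m i : ℕ))
    (fun t => alDMod (xv n) n (ellOf n h m) (i.val + 1) (h (i.val + 1) - t))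
    fun t _ => isHomogeneous_alDMod _ _ _
  rwa [Finset.card_range] at h0

end Assembly

/-- **Theorem 5.17 (type D).** For a Hessenberg function `h` of type `D_n` (`n ≥ 2`), the
classes `v^{(h)}_m` with `0 ≤ m_i ≤ h(i)−i` form an ℝ-basis of
`H^*(Hess(N,h)) ≅ R^{D}_h`. -/
theorem stmt_8 (n : ℕ) (hn : 2 ≤ n) (h : ℕ → ℕ)
    (hh1 : ∀ i ∈ Finset.Icc 1 (n - 1), i ≤ h i ∧ h i ≤ 2 * n - 1 - i)
    (hh2 : n ≤ h n ∧ h n ≤ 2 * n - 1)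
    (hh3 : ∀ i ∈ Finset.Icc 1 (n - 2), h i ≠ 2 * n - 1 - i → h i ≤ h (i + 1))
    (hh4 : ∀ i ∈ Finset.Icc 1 (n - 2), h i = 2 * n - 1 - i → h (i + 1) = 2 * n - 1 - (i + 1))
    (hh5 : ∀ i ∈ Finset.Icc 1 (n - 2), n + 1 ≤ h i → 2 * n - i ≤ h n)
    (hh6 : ∀ i ∈ Finset.Icc 1 (n - 2), 2 * n - i ≤ h n → n - 1 ≤ h i) :
    LinearIndependent ℝ (vDh n h) ∧
      Submodule.span ℝ (Set.range (vDh n h)) = ⊤ := by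
  have H : HessD n h := by
    constructor
    · intro i hi hin
      exact (hh1 i (Finset.mem_Icc.2 ⟨hi, by omega⟩)).1
    · intro i hi hin
      have := (hh1 i (Finset.mem_Icc.2 ⟨hi, by omega⟩)).2
      omega
    · exact hh2.1
    · omega
    · intro i hi hin
      have h3 := hh3 i (Finset.mem_Icc.2 ⟨hi, by omega⟩)
      have h4 := hh4 i (Finset.mem_Icc.2 ⟨hi, by omega⟩)
      omega
    · intro i hi hin
      have h5 := hh5 i (Finset.mem_Icc.2 ⟨hi, by omega⟩)
      omega
    · intro i hi hin
      have h6 := hh6 i (Finset.mem_Icc.2 ⟨hi, by omega⟩)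
      omega
  exact ⟨H.linearIndependent_vDh, H.span_vDh⟩
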